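/- There exist constants C > 0 and K ≥ 0 such that for all real N ≥ 16 one has C(N) ≤ C · N · (log log N)^K / (log N)^η, where η = 1 − (1 + log log 2)/log 2 is the Erdős–Ford–Tenenbaum constant. -/

import Mathlib

open Real

/-- `countC N` is the number of integers `n` with `1 < n ≤ N` such that `n = a * b`
for some positive integers `a, b` with `a² + b²` prime. -/
noncomputable def countC (N : ℝ) : ℕ :=
  {n : ℕ | 1 < n ∧ (n : ℝ) ≤ N ∧
    ∃ a b : ℕ, 0 < a ∧ 0 < b ∧ n = a * b ∧ Nat.Prime (a ^ 2 + b ^ 2)}.ncard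

theorem sum_Ioc_sum_divisors {M : Type*} [AddCommMonoid M] (F : ℕ → ℕ → M) (n : ℕ) :
    ∑ k ∈ Finset.Ioc 0 n, ∑ d ∈ k.divisors, F d (k / d) =
      ∑ d ∈ Finset.Ioc 0 n, ∑ m ∈ Finset.Ioc 0 (n / d), F d m := by
  rw [Finset.sum_sigma', Finset.sum_sigma']
  refine Finset.sum_nbij' (fun x => ⟨x.2, x.1 / x.2⟩) (fun x => ⟨x.1 * x.2, x.1⟩) ?_ ?_ ?_ ?_ ?_
  · rintro ⟨k, d⟩ h
    simp only [Finset.mem_sigma, Finset.mem_Ioc, Nat.mem_divisors] at h ⊢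
    obtain ⟨⟨hk, hkn⟩, hd, -⟩ := h
    have hd0 : 0 < d := Nat.pos_of_dvd_of_pos hd hk
    exact ⟨⟨hd0, (Nat.le_of_dvd hk hd).trans hkn⟩, Nat.div_pos (Nat.le_of_dvd hk hd) hd0,
      Nat.div_le_div_right hkn⟩
  · rintro ⟨d, m⟩ h
    simp only [Finset.mem_sigma, Finset.mem_Ioc, Nat.mem_divisors] at h ⊢
    obtain ⟨⟨hd, hdn⟩, hm, hmn⟩ := h
    have h1 := (Nat.le_div_iff_mul_le hd).1 hmn
    exact ⟨⟨by positivity, by rwa [mul_comm]⟩, dvd_mul_right _ _, by positivity⟩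
  · rintro ⟨k, d⟩ h
    simp only [Finset.mem_sigma, Finset.mem_Ioc, Nat.mem_divisors] at h
    simp [Nat.mul_div_cancel' h.2.1]
  · rintro ⟨d, m⟩ h
    simp only [Finset.mem_sigma, Finset.mem_Ioc] at h
    simp [Nat.mul_div_cancel_left _ h.1.1]
  · rintro ⟨k, d⟩ h
    rfl

theorem sum_primesLE_le_sum_Ioc {f : ℕ → ℝ} (hf : ∀ k, 0 ≤ f k) (n : ℕ) :
    ∑ p ∈ n.primesLE, f p ≤ ∑ d ∈ Finset.Ioc 0 n, f d := by
  rw [Nat.primesLE_eq_filter_Ioc_zero]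
  exact Finset.sum_le_sum_of_subset_of_nonneg (Finset.filter_subset _ _) fun i _ _ => hf i

open scoped ArithmeticFunction.vonMangoldt in
theorem sum_vonMangoldt_div_le (n : ℕ) (hn : 1 ≤ n) :
    ∑ d ∈ Finset.Ioc 0 n, Λ d / d ≤ log n + (log 4 + 4) := by
  have h1 : ∑ k ∈ Finset.Ioc 0 n, log k = ∑ d ∈ Finset.Ioc 0 n, Λ d * (n / d : ℕ) := by
    have := sum_Ioc_sum_divisors (fun d _ => Λ d) n
    simp only [ArithmeticFunction.vonMangoldt_sum, Finset.sum_const, Nat.card_Ioc, nsmul_eq_mul] at this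
    rw [this]
    exact Finset.sum_congr rfl fun d _ => by rw [mul_comm]; simp
  have h2 : ∑ k ∈ Finset.Ioc 0 n, log k ≤ n * log n := by
    have : ∑ k ∈ Finset.Ioc 0 n, log k ≤ ∑ k ∈ Finset.Ioc 0 n, log n := by
      refine Finset.sum_le_sum fun k hk => ?_
      rw [Finset.mem_Ioc] at hk
      exact log_le_log (by exact_mod_cast hk.1) (by exact_mod_cast hk.2)
    simpa using this
  have h3 : ∑ d ∈ Finset.Ioc 0 n, Λ d ≤ (log 4 + 4) * n := by
    have := Chebyshev.psi_le_const_mul_self (x := n) (by positivity)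
    simpa [Chebyshev.psi] using this
  have h4 : ∑ d ∈ Finset.Ioc 0 n, Λ d * ((n : ℝ) / d - 1) ≤
      ∑ d ∈ Finset.Ioc 0 n, Λ d * (n / d : ℕ) := by
    refine Finset.sum_le_sum fun d hd => ?_
    refine mul_le_mul_of_nonneg_left ?_ ArithmeticFunction.vonMangoldt_nonneg
    rw [← Nat.floor_div_eq_div (K := ℝ)]
    linarith [Nat.lt_floor_add_one ((n : ℝ) / d)]
  have h5 : ∑ d ∈ Finset.Ioc 0 n, Λ d * ((n : ℝ) / d - 1) =
      n * ∑ d ∈ Finset.Ioc 0 n, Λ d / d - ∑ d ∈ Finset.Ioc 0 n, Λ d := by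
    rw [Finset.mul_sum, ← Finset.sum_sub_distrib]
    exact Finset.sum_congr rfl fun d _ => by ring
  have hn' : (0 : ℝ) < n := by exact_mod_cast hn
  refine le_of_mul_le_mul_left ?_ hn'
  linarith

theorem sum_log_div_primesLE_le (n : ℕ) (hn : 1 ≤ n) :
    ∑ p ∈ n.primesLE, log p / p ≤ log n + (log 4 + 4) := by
  refine le_trans ?_ (sum_vonMangoldt_div_le n hn)
  refine le_trans (le_of_eq ?_) (sum_primesLE_le_sum_Ioc
    (f := fun d => ArithmeticFunction.vonMangoldt d / d)
    (fun k => div_nonneg ArithmeticFunction.vonMangoldt_nonneg (by positivity)) n)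
  exact Finset.sum_congr rfl fun p hp => by
    rw [ArithmeticFunction.vonMangoldt_apply_prime (Nat.prime_of_mem_primesLE hp)]

theorem sum_inv_primesLE_le :
    ∃ C : ℝ, 0 ≤ C ∧ ∀ n : ℕ, 2 ≤ n → ∑ p ∈ n.primesLE, (p : ℝ)⁻¹ ≤ log (log n) + C := by
  set c : ℝ := log 4 + 4
  have hc : 0 ≤ c := by have := log_nonneg (show (1 : ℝ) ≤ 4 by norm_num); positivity
  set A : ℕ → ℝ := fun n => ∑ p ∈ n.primesLE, log p / p
  have hA : ∀ n, 1 ≤ n → A n ≤ log n + c := sum_log_div_primesLE_le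
  set S : ℕ → ℝ := fun n => ∑ p ∈ n.primesLE, (p : ℝ)⁻¹
  set G : ℕ → ℝ := fun n => S n - A n / log n + c / log n - log (log n)
  have hstep : ∀ n, 2 ≤ n → G (n + 1) ≤ G n := by
    intro n hn
    have hl : 0 < log n := log_pos (by exact_mod_cast hn)
    have hl' : 0 < log ((n + 1 : ℕ) : ℝ) := log_pos (by exact_mod_cast (by omega))
    have hlt : log n ≤ log ((n + 1 : ℕ) : ℝ) :=
      log_le_log (by positivity) (by exact_mod_cast Nat.le_succ n)
    have hSA : S (n + 1) - A (n + 1) / log ((n + 1 : ℕ) : ℝ) =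
        S n - A n / log ((n + 1 : ℕ) : ℝ) := by
      simp only [S, A]
      rw [Nat.primesLE_succ]
      split_ifs with hp
      · rw [Finset.sum_insert (Nat.notMem_primesLE n), Finset.sum_insert (Nat.notMem_primesLE n)]
        field_simp
        ring
      · rfl
    have h1 : log (log n) - log (log ((n + 1 : ℕ) : ℝ)) ≤ log n / log ((n + 1 : ℕ) : ℝ) - 1 := by
      rw [← log_div hl.ne' hl'.ne']
      exact log_le_sub_one_of_pos (by positivity)
    have h2 : A n * ((log n)⁻¹ - (log ((n + 1 : ℕ) : ℝ))⁻¹) ≤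
        (log n + c) * ((log n)⁻¹ - (log ((n + 1 : ℕ) : ℝ))⁻¹) := by
      refine mul_le_mul_of_nonneg_right (hA n (by omega)) ?_
      rw [sub_nonneg]
      gcongr
    have h3 : log n * (log n)⁻¹ = 1 := mul_inv_cancel₀ hl.ne'
    simp only [G]
    rw [hSA]
    simp only [div_eq_mul_inv] at h1 ⊢
    linarith
  have hG : ∀ n, 2 ≤ n → G n ≤ G 2 := by
    intro n hn
    induction n, hn using Nat.le_induction with
    | base => exact le_rfl
    | succ n hn ih => exact (hstep n hn).trans ih
  refine ⟨|G 2| + 1 + c / log 2, by positivity, fun n hn => ?_⟩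
  have hl2 : 0 < log 2 := log_pos (by norm_num)
  have hl : log 2 ≤ log n := log_le_log (by norm_num) (by exact_mod_cast hn)
  have h1 := hG n hn
  have h2 : A n / log n ≤ 1 + c / log n := by
    rw [div_le_iff₀ (by linarith), add_mul, div_mul_cancel₀ _ (by linarith)]
    linarith [hA n (by omega)]
  have h3 := le_abs_self (G 2)
  have h4 : 0 ≤ c / log 2 := by positivity
  change S n ≤ _
  simp only [G] at h1 h3 ⊢
  linarith

theorem sum_inv_sq_primesLE_le_one (n : ℕ) : ∑ p ∈ n.primesLE, ((p : ℝ) ^ 2)⁻¹ ≤ 1 := by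
  rcases Nat.eq_zero_or_pos n with rfl | hn
  · simp
  have h := sum_Ioc_inv_sq_le_sub (α := ℝ) one_ne_zero hn
  rw [Nat.primesLE_eq_filter_Ioc_one]
  refine (Finset.sum_le_sum_of_subset_of_nonneg (Finset.filter_subset _ _)
    fun i _ _ => by positivity).trans (h.trans ?_)
  have : (0 : ℝ) ≤ (n : ℝ)⁻¹ := by positivity
  simp only [Nat.cast_one, inv_one]
  linarith

/-- Partial sums of a multiplicative function of the size of a reciprocal are bounded by
the exponential of its sum over primes. -/
theorem sum_Ioc_le_exp_sum_primesLE {f : ℕ → ℝ} (h1 : f 1 = 1)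
    (hmul : ∀ {m n : ℕ}, m.Coprime n → f (m * n) = f m * f n) (h0 : ∀ n, 0 ≤ f n) {M : ℝ}
    (hM : 0 ≤ M) (hf : ∀ p k : ℕ, p.Prime → f (p ^ k) ≤ M * (k + 1) / (p : ℝ) ^ k) (n : ℕ) :
    ∑ k ∈ Finset.Ioc 0 n, f k ≤ exp (∑ p ∈ n.primesLE, f p + 8 * M) := by
  have hg : HasSum (fun k : ℕ => ((k : ℝ) + 3) * (1 / 2 : ℝ) ^ k) 8 := by
    have e1 := hasSum_coe_mul_geometric_of_norm_lt_one (r := (1 / 2 : ℝ)) (by norm_num)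
    have e2 := (hasSum_geometric_of_norm_lt_one (ξ := (1 / 2 : ℝ)) (by norm_num)).mul_left 3
    have := e1.add e2
    rw [show (8 : ℝ) = 1 / 2 / (1 - 1 / 2) ^ 2 + 3 * (1 - 1 / 2)⁻¹ by norm_num]
    simpa only [add_mul] using this
  have hb : ∀ p k : ℕ, p.Prime →
      f (p ^ (k + 2)) ≤ M * ((p : ℝ) ^ 2)⁻¹ * (((k : ℝ) + 3) * (1 / 2 : ℝ) ^ k) := by
    intro p k hp
    have hp2 : (2 : ℝ) ≤ p := by exact_mod_cast hp.two_le
    refine (hf p (k + 2) hp).trans ?_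
    rw [pow_add, div_eq_mul_inv, mul_inv]
    have : ((p : ℝ) ^ k)⁻¹ ≤ (1 / 2) ^ k := by
      rw [← inv_pow]
      refine pow_le_pow_left₀ (by positivity) ?_ k
      rw [one_div]
      gcongr
    calc M * (((k + 2 : ℕ) : ℝ) + 1) * (((p : ℝ) ^ k)⁻¹ * ((p : ℝ) ^ 2)⁻¹)
        ≤ M * (((k + 2 : ℕ) : ℝ) + 1) * ((1 / 2) ^ k * ((p : ℝ) ^ 2)⁻¹) := by gcongr
      _ = _ := by push_cast; ring
  have hs2 : ∀ p : ℕ, p.Prime → Summable fun k => f (p ^ (k + 2)) := fun p hp =>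
    Summable.of_nonneg_of_le (fun k => h0 _) (fun k => hb p k hp)
      (hg.summable.mul_left _)
  have hs : ∀ p : ℕ, p.Prime → Summable fun k => f (p ^ k) := fun p hp =>
    (summable_nat_add_iff 2).1 (hs2 p hp)
  have hE := EulerProduct.summable_and_hasSum_smoothNumbers_prod_primesBelow_tsum h1 hmul
    (fun {p} hp => (hs p hp).norm) (n + 1)
  have hle : ∑ k ∈ Finset.Ioc 0 n, f k ≤
      ∏ p ∈ (n + 1).primesBelow, ∑' k : ℕ, f (p ^ k) := by
    classical
    rw [← Finset.sum_subtype_of_mem (p := fun k => k ∈ (n + 1).smoothNumbers) f]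
    · exact sum_le_hasSum _ (fun i _ => h0 _) hE.2
    · intro k hk
      rw [Finset.mem_Ioc] at hk
      exact Nat.mem_smoothNumbers_of_lt hk.1 (by omega)
  refine hle.trans ?_
  have hprod : ∏ p ∈ (n + 1).primesBelow, ∑' k : ℕ, f (p ^ k) ≤
      ∏ p ∈ n.primesLE, exp (f p + 8 * M * ((p : ℝ) ^ 2)⁻¹) := by
    refine Finset.prod_le_prod (fun p _ => tsum_nonneg fun k => h0 _) fun p hp => ?_
    have hp := Nat.prime_of_mem_primesLE hp
    rw [← (hs p hp).sum_add_tsum_nat_add 2]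
    have h3 : ∑' k, f (p ^ (k + 2)) ≤ M * ((p : ℝ) ^ 2)⁻¹ * 8 := by
      rw [← (hg.mul_left (M * ((p : ℝ) ^ 2)⁻¹)).tsum_eq]
      exact (hs2 p hp).tsum_le_tsum (fun k => hb p k hp) (hg.summable.mul_left _)
    simp only [Finset.sum_range_succ, Finset.sum_range_zero, pow_zero, pow_one, h1]
    linarith [add_one_le_exp (f p + 8 * M * ((p : ℝ) ^ 2)⁻¹)]
  refine hprod.trans ?_
  rw [← exp_sum, Finset.sum_add_distrib, ← Finset.mul_sum]
  refine exp_le_exp.2 (add_le_add_right ?_ _)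
  exact mul_le_of_le_one_right (by positivity) (sum_inv_sq_primesLE_le_one n)

theorem card_primeFactors_mul_of_coprime {m n : ℕ} (h : m.Coprime n) :
    (m * n).primeFactors.card = m.primeFactors.card + n.primeFactors.card := by
  rw [h.primeFactors_mul, Finset.card_union_of_disjoint h.disjoint_primeFactors]

theorem sum_pow_card_primeFactors_div_le {y : ℝ} (hy : 0 < y) :
    ∃ C : ℝ, 0 < C ∧ ∀ n : ℕ, 2 ≤ n →
      ∑ k ∈ Finset.Ioc 0 n, y ^ k.primeFactors.card / k ≤ C * log n ^ y := by
  obtain ⟨c, hc, hS⟩ := sum_inv_primesLE_le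
  refine ⟨exp (y * c + 8 * (y + 1)), exp_pos _, fun n hn => ?_⟩
  have h := sum_Ioc_le_exp_sum_primesLE (f := fun k => y ^ k.primeFactors.card / k) (by simp)
    (fun {m n} h => by
      simp only [card_primeFactors_mul_of_coprime h, pow_add, Nat.cast_mul]
      ring)
    (fun n => by positivity) (M := y + 1) (by positivity)
    (fun p k hp => by
      push_cast
      gcongr
      rcases Nat.eq_zero_or_pos k with rfl | hk
      · simp; linarith
      · rw [Nat.primeFactors_prime_pow hk.ne' hp]
        simp only [Finset.card_singleton, pow_one]
        nlinarith [show (0 : ℝ) ≤ k by positivity]) n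
  refine h.trans ?_
  have hl : 0 < log n := log_pos (by exact_mod_cast hn)
  rw [rpow_def_of_pos hl, ← exp_add]
  refine exp_le_exp.2 ?_
  have : ∑ p ∈ n.primesLE, y ^ p.primeFactors.card / (p : ℝ) =
      y * ∑ p ∈ n.primesLE, (p : ℝ)⁻¹ := by
    rw [Finset.mul_sum]
    refine Finset.sum_congr rfl fun p hp => ?_
    rw [(Nat.prime_of_mem_primesLE hp).primeFactors]
    simp [div_eq_mul_inv]
  rw [this]
  nlinarith [hS n hn]

theorem log_le_sum_Ioc_inv (n : ℕ) : log n ≤ ∑ k ∈ Finset.Ioc 0 n, (k : ℝ)⁻¹ := by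
  have h := log_add_one_le_harmonic n
  rw [harmonic_eq_sum_Icc] at h
  push_cast at h
  refine le_trans ?_ h
  rcases Nat.eq_zero_or_pos n with rfl | hn
  · simp
  exact log_le_log (by positivity) (by linarith)

theorem loglog_le_sum_inv_primesLE (n : ℕ) (hn : 2 ≤ n) :
    log (log n) ≤ ∑ p ∈ n.primesLE, (p : ℝ)⁻¹ + 8 := by
  have h := sum_Ioc_le_exp_sum_primesLE (f := fun k => (k : ℝ)⁻¹) (by simp)
    (fun {m n} h => by push_cast; rw [mul_inv]) (fun n => by positivity) (M := 1) (by positivity)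
    (fun p k hp => by
      push_cast
      rw [← one_div]
      gcongr
      nlinarith [show (0 : ℝ) ≤ k by positivity]) n
  have hl : 0 < log n := log_pos (by exact_mod_cast hn)
  rw [log_le_iff_le_exp hl]
  have := (log_le_sum_Ioc_inv n).trans h
  rwa [mul_one] at this

open ZMod

theorem sum_χ₄_div_ge (k : ℕ) (hk : 1 ≤ k) :
    (2 / 3 : ℝ) ≤ ∑ d ∈ Finset.Ioc 0 k, (χ₄ d : ℝ) / d := by
  set T : ℕ → ℝ := fun k => ∑ d ∈ Finset.Ioc 0 k, (χ₄ d : ℝ) / d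
  have hT : ∀ k, T (k + 1) = T k + (χ₄ (k + 1 : ℕ) : ℝ) / (k + 1 : ℕ) := fun k => by
    simp only [T]
    rw [Finset.sum_Ioc_succ_top (by omega)]
  have h0 : T 0 = 0 := by simp [T]
  have e1 : ∀ j, T (4 * j + 1) = T (4 * j) + 1 / (4 * j + 1) := fun j => by
    rw [hT, χ₄_nat_eq_if_mod_four, if_neg (by omega), if_pos (by omega)]
    push_cast; ring
  have e2 : ∀ j, T (4 * j + 2) = T (4 * j + 1) := fun j => by
    rw [hT, χ₄_nat_eq_if_mod_four, if_pos (by omega)]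
    push_cast; ring
  have e3 : ∀ j, T (4 * j + 3) = T (4 * j + 2) - 1 / (4 * j + 3) := fun j => by
    rw [hT, χ₄_nat_eq_if_mod_four, if_neg (by omega), if_neg (by omega)]
    push_cast; ring
  have e4 : ∀ j, T (4 * (j + 1)) = T (4 * j + 3) := fun j => by
    rw [show 4 * (j + 1) = 4 * j + 3 + 1 by ring, hT, χ₄_nat_eq_if_mod_four, if_pos (by omega)]
    push_cast; ring
  have hd : ∀ j : ℕ, (1 : ℝ) / (4 * j + 3) ≤ 1 / (4 * j + 1) := fun j => by gcongr; norm_num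
  have hp : ∀ j : ℕ, (0 : ℝ) < 1 / (4 * j + 1) := fun j => by positivity
  have h4 : ∀ j, 2 / 3 ≤ T (4 * (j + 1)) := by
    intro j
    induction j with
    | zero => rw [e4, e3, e2, e1, mul_zero, h0]; norm_num
    | succ j ih => rw [e4, e3, e2, e1]; linarith [hd (j + 1)]
  obtain ⟨j, r, hr, rfl⟩ : ∃ j r, r < 4 ∧ k = 4 * j + r := ⟨k / 4, k % 4, by omega, by omega⟩
  change 2 / 3 ≤ T (4 * j + r)
  rcases j with _ | j
  · have h1 : T 1 = 1 := by rw [← zero_add 1, ← mul_zero 4, e1, mul_zero, h0]; norm_num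
    have h2 : T 2 = 1 := h1 ▸ e2 0
    have h3 : T 3 = 2 / 3 := by
      have := e3 0
      rw [mul_zero, zero_add, zero_add, h2] at this
      rw [this]; norm_num
    rw [mul_zero, zero_add] at hk ⊢
    interval_cases r <;> linarith
  · have := h4 j; have := e1 (j + 1); have := e2 (j + 1); have := e3 (j + 1); have := hd (j + 1)
    have := hp (j + 1)
    interval_cases r
    · exact h4 j
    all_goals linarith

/-- The character `χ₄` as a real arithmetic function. -/
noncomputable def chiFour : ArithmeticFunction ℝ := ⟨fun n => (χ₄ n : ℝ), by simp⟩

theorem chiFour_apply (n : ℕ) : chiFour n = (χ₄ n : ℝ) := rfl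

theorem isMultiplicative_chiFour : chiFour.IsMultiplicative := by
  refine ⟨by simp [chiFour_apply], fun {m n} _ => ?_⟩
  rw [chiFour_apply, chiFour_apply, chiFour_apply, Nat.cast_mul, map_mul, Int.cast_mul]

theorem chiFour_mul_zeta_prime_pow {p : ℕ} (hp : p.Prime) (k : ℕ) :
    (chiFour * ArithmeticFunction.zeta) (p ^ k) =
      ∑ i ∈ Finset.range (k + 1), (χ₄ p : ℝ) ^ i := by
  rw [ArithmeticFunction.coe_mul_zeta_apply, Nat.sum_divisors_prime_pow hp]
  refine Finset.sum_congr rfl fun i _ => ?_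
  rw [chiFour_apply, Nat.cast_pow, map_pow, Int.cast_pow]

theorem χ₄_cases (p : ℕ) : (χ₄ p : ℝ) = 0 ∨ (χ₄ p : ℝ) = 1 ∨ (χ₄ p : ℝ) = -1 := by
  rw [χ₄_nat_eq_if_mod_four]
  split_ifs <;> simp

theorem chiFour_mul_zeta_prime_pow_nonneg {p : ℕ} (hp : p.Prime) (k : ℕ) :
    0 ≤ (chiFour * ArithmeticFunction.zeta) (p ^ k) := by
  rw [chiFour_mul_zeta_prime_pow hp]
  rcases χ₄_cases p with h | h | h <;> rw [h]
  · exact Finset.sum_nonneg fun i _ => by positivity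
  · exact Finset.sum_nonneg fun i _ => by positivity
  · rw [neg_one_geom_sum]; split_ifs <;> norm_num

theorem chiFour_mul_zeta_nonneg (n : ℕ) : 0 ≤ (chiFour * ArithmeticFunction.zeta) n := by
  have hm := isMultiplicative_chiFour.mul ArithmeticFunction.isMultiplicative_zeta.natCast
  induction n using Nat.recOnPosPrimePosCoprime with
  | prime_pow p n hp _ => exact chiFour_mul_zeta_prime_pow_nonneg hp n
  | zero => simp
  | one => rw [hm.1]; norm_num
  | coprime a b _ _ h ha hb => rw [hm.2 h]; positivity

theorem loglog_le_sum_one_add_χ₄_div_primesLE (n : ℕ) (hn : 2 ≤ n) :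
    log (log n) ≤ ∑ p ∈ n.primesLE, (1 + (χ₄ p : ℝ)) / p + 9 := by
  have hm := isMultiplicative_chiFour.mul ArithmeticFunction.isMultiplicative_zeta.natCast
  set r := chiFour * (ArithmeticFunction.zeta : ArithmeticFunction ℝ) with hr
  have h := sum_Ioc_le_exp_sum_primesLE (f := fun k => r k / k) (by simp [hm.1])
    (fun {m n} h => by simp only [hm.2 h]; push_cast; ring)
    (fun n => div_nonneg (chiFour_mul_zeta_nonneg n) (by positivity)) (M := 1) (by positivity)
    (fun p k hp => by
      push_cast
      gcongr
      rw [hr, chiFour_mul_zeta_prime_pow hp]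
      calc ∑ i ∈ Finset.range (k + 1), (χ₄ p : ℝ) ^ i ≤ ∑ i ∈ Finset.range (k + 1), 1 :=
            Finset.sum_le_sum fun i _ => by
              refine (le_abs_self _).trans ?_
              rw [abs_pow]
              refine pow_le_one₀ (abs_nonneg _) ?_
              rcases χ₄_cases p with h | h | h <;> rw [h] <;> norm_num
        _ = _ := by simp) n
  have h2 : ∑ p ∈ n.primesLE, r p / (p : ℝ) = ∑ p ∈ n.primesLE, (1 + (χ₄ p : ℝ)) / p :=
    Finset.sum_congr rfl fun p hp => by
      have := chiFour_mul_zeta_prime_pow (Nat.prime_of_mem_primesLE hp) 1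
      simp only [pow_one, Finset.sum_range_succ, Finset.sum_range_zero, pow_zero, zero_add] at this
      rw [hr, this]
  rw [h2] at h
  have h3 : 2 / 3 * log n ≤ ∑ k ∈ Finset.Ioc 0 n, r k / (k : ℝ) := by
    have e : ∑ k ∈ Finset.Ioc 0 n, r k / (k : ℝ) =
        ∑ m ∈ Finset.Ioc 0 n, ∑ d ∈ Finset.Ioc 0 (n / m), (m : ℝ)⁻¹ * ((χ₄ d : ℝ) / d) := by
      rw [← sum_Ioc_sum_divisors (fun m d => (m : ℝ)⁻¹ * ((χ₄ d : ℝ) / d)) n]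
      refine Finset.sum_congr rfl fun k hk => ?_
      rw [hr, ArithmeticFunction.coe_mul_zeta_apply, Finset.sum_div,
        ← Nat.sum_div_divisors k fun d => chiFour d / (k : ℝ)]
      refine Finset.sum_congr rfl fun d hd => ?_
      have hk0 : k ≠ 0 := (Nat.mem_divisors.1 hd).2
      obtain ⟨c, rfl⟩ := (Nat.mem_divisors.1 hd).1
      have hd0 : d ≠ 0 := by rintro rfl; simp at hk0
      rw [Nat.mul_div_cancel_left _ (Nat.pos_of_ne_zero hd0), chiFour_apply]
      push_cast
      rw [← div_eq_inv_mul, div_div, mul_comm (c : ℝ)]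
    rw [e]
    calc 2 / 3 * log n ≤ 2 / 3 * ∑ m ∈ Finset.Ioc 0 n, (m : ℝ)⁻¹ := by
          gcongr; exact log_le_sum_Ioc_inv n
      _ = ∑ m ∈ Finset.Ioc 0 n, (m : ℝ)⁻¹ * (2 / 3) := by rw [mul_comm, Finset.sum_mul]
      _ ≤ _ := by
          refine Finset.sum_le_sum fun m hm => ?_
          rw [Finset.mem_Ioc] at hm
          rw [← Finset.mul_sum]
          gcongr
          exact sum_χ₄_div_ge _ (Nat.div_pos hm.2 hm.1)
  have hl : 0 < log n := log_pos (by exact_mod_cast hn)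
  rw [log_le_iff_le_exp hl]
  have h4 := h3.trans h
  have h5 : (2 : ℝ) ≤ exp 1 := by linarith [add_one_le_exp (1 : ℝ)]
  rw [show ∑ p ∈ n.primesLE, (1 + (χ₄ p : ℝ)) / (p : ℝ) + 9 =
    (∑ p ∈ n.primesLE, (1 + (χ₄ p : ℝ)) / (p : ℝ) + 8 * 1) + 1 by ring, exp_add _ 1]
  nlinarith [exp_pos (∑ p ∈ n.primesLE, (1 + (χ₄ p : ℝ)) / (p : ℝ) + 8 * 1)]

theorem pow_card_primeFactors_mul_le {y : ℝ} (hy : 1 ≤ y) {d m : ℕ} (hd : IsPrimePow d) :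
    y ^ (d * m).primeFactors.card ≤ y * y ^ m.primeFactors.card := by
  rw [← pow_succ']
  refine pow_le_pow_right₀ hy ?_
  rcases Nat.eq_zero_or_pos m with rfl | hm
  · simp
  obtain ⟨p, k, hp, hk, rfl⟩ := hd
  rw [Nat.primeFactors_mul (pow_ne_zero _ hp.ne_zero) hm.ne',
    Nat.primeFactors_prime_pow hk.ne' (Nat.prime_iff.2 hp)]
  exact (Finset.card_union_le _ _).trans (by simp [add_comm])

open scoped ArithmeticFunction.vonMangoldt in
theorem sum_pow_card_primeFactors_mul_log_le {y : ℝ} (hy : 1 ≤ y) (n : ℕ) :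
    ∑ k ∈ Finset.Ioc 0 n, y ^ k.primeFactors.card * log k ≤
      y * (log 4 + 4) * n * ∑ k ∈ Finset.Ioc 0 n, y ^ k.primeFactors.card / k := by
  have h1 : ∑ k ∈ Finset.Ioc 0 n, y ^ k.primeFactors.card * log k =
      ∑ m ∈ Finset.Ioc 0 n, ∑ d ∈ Finset.Ioc 0 (n / m), Λ d * y ^ (m * d).primeFactors.card := by
    rw [← sum_Ioc_sum_divisors fun m d => Λ d * y ^ (m * d).primeFactors.card]
    refine Finset.sum_congr rfl fun k _ => ?_
    rw [← ArithmeticFunction.vonMangoldt_sum, Finset.mul_sum, ← Nat.sum_div_divisors]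
    refine Finset.sum_congr rfl fun d hd => ?_
    rw [Nat.mul_div_cancel' (Nat.mem_divisors.1 hd).1, mul_comm]
  rw [h1, Finset.mul_sum]
  refine Finset.sum_le_sum fun m hm => ?_
  rw [Finset.mem_Ioc] at hm
  have h2 : ∑ d ∈ Finset.Ioc 0 (n / m), Λ d ≤ (log 4 + 4) * (n / m) := by
    have := Chebyshev.psi_le_const_mul_self (x := n / m) (by positivity)
    simpa [Chebyshev.psi, Nat.floor_div_eq_div] using this
  calc ∑ d ∈ Finset.Ioc 0 (n / m), Λ d * y ^ (m * d).primeFactors.card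
      ≤ ∑ d ∈ Finset.Ioc 0 (n / m), Λ d * (y * y ^ m.primeFactors.card) := by
        refine Finset.sum_le_sum fun d _ => ?_
        by_cases hd : IsPrimePow d
        · rw [mul_comm m]
          exact mul_le_mul_of_nonneg_left (pow_card_primeFactors_mul_le hy hd)
            ArithmeticFunction.vonMangoldt_nonneg
        · simp [ArithmeticFunction.vonMangoldt_eq_zero_iff.2 hd]
    _ = (∑ d ∈ Finset.Ioc 0 (n / m), Λ d) * (y * y ^ m.primeFactors.card) := by
        rw [Finset.sum_mul]
    _ ≤ (log 4 + 4) * (n / m) * (y * y ^ m.primeFactors.card) := by gcongr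
    _ = _ := by ring

theorem sum_pow_card_primeFactors_le {y : ℝ} (hy : 1 ≤ y) :
    ∃ C : ℝ, 0 < C ∧ ∀ n : ℕ, 2 ≤ n →
      ∑ k ∈ Finset.Ioc 0 n, y ^ k.primeFactors.card ≤ C * n * log n ^ (y - 1) := by
  obtain ⟨c, hc, h⟩ := sum_pow_card_primeFactors_div_le (y := y) (by linarith)
  have hl4 : 0 < log 4 := log_pos (by norm_num)
  refine ⟨(y * (log 4 + 4) + 1) * c, by positivity, fun n hn => ?_⟩
  have hl : 0 < log n := log_pos (by exact_mod_cast hn)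
  set S := ∑ k ∈ Finset.Ioc 0 n, y ^ k.primeFactors.card / (k : ℝ)
  have h1 : ∑ k ∈ Finset.Ioc 0 n, y ^ k.primeFactors.card * (log n - log k) ≤ n * S := by
    rw [Finset.mul_sum]
    refine Finset.sum_le_sum fun k hk => ?_
    rw [Finset.mem_Ioc] at hk
    have hk0 : (0 : ℝ) < k := by exact_mod_cast hk.1
    have hn0 : (0 : ℝ) < n := by positivity
    rw [← log_div hn0.ne' hk0.ne']
    calc y ^ k.primeFactors.card * log (n / k) ≤ y ^ k.primeFactors.card * (n / k) := by
          gcongr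
          linarith [log_le_sub_one_of_pos (div_pos hn0 hk0)]
      _ = _ := by ring
  have h2 := sum_pow_card_primeFactors_mul_log_le hy n
  have h3 : log n * ∑ k ∈ Finset.Ioc 0 n, y ^ k.primeFactors.card ≤
      (y * (log 4 + 4) + 1) * n * S := by
    have : log n * ∑ k ∈ Finset.Ioc 0 n, y ^ k.primeFactors.card =
        ∑ k ∈ Finset.Ioc 0 n, y ^ k.primeFactors.card * (log n - log k) +
        ∑ k ∈ Finset.Ioc 0 n, y ^ k.primeFactors.card * log k := by
      rw [← Finset.sum_add_distrib, Finset.mul_sum]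
      exact Finset.sum_congr rfl fun k _ => by ring
    rw [this]
    linarith
  have h4 : (y * (log 4 + 4) + 1) * n * S ≤ (y * (log 4 + 4) + 1) * n * (c * log n ^ y) := by
    gcongr
    exact h n hn
  rw [rpow_sub_one hl.ne', ← mul_div_assoc, le_div_iff₀ hl]
  linarith

/-- The truncated inclusion–exclusion sum. -/
noncomputable def truncSum {ι : Type*} (t : ι → ℝ) (s : Finset ι) (k : ℕ) : ℝ :=
  ∑ j ∈ Finset.range k, (-1) ^ j * ∑ D ∈ s.powersetCard j, ∏ i ∈ D, t i

theorem truncSum_insert {ι : Type*} [DecidableEq ι] (t : ι → ℝ) {s : Finset ι} {a : ι}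
    (ha : a ∉ s) (k : ℕ) :
    truncSum t (insert a s) (k + 1) = truncSum t s (k + 1) - t a * truncSum t s k := by
  unfold truncSum
  rw [Finset.sum_range_succ', Finset.sum_range_succ' _ k]
  simp only [Finset.powersetCard_zero]
  rw [Finset.mul_sum (Finset.range k) _ (t a), add_sub_right_comm, ← Finset.sum_sub_distrib]
  congr 1
  refine Finset.sum_congr rfl fun j _ => ?_
  rw [Finset.powersetCard_succ_insert ha, Finset.sum_union, Finset.sum_image]
  · have : ∑ D ∈ s.powersetCard j, ∏ i ∈ insert a D, t i =
        t a * ∑ D ∈ s.powersetCard j, ∏ i ∈ D, t i := by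
      rw [Finset.mul_sum]
      refine Finset.sum_congr rfl fun D hD => ?_
      rw [Finset.prod_insert fun h => ha ((Finset.mem_powersetCard.1 hD).1 h)]
    rw [this]
    ring
  · intro D hD E hE h
    have hD' : a ∉ D := fun h => ha ((Finset.mem_powersetCard.1 hD).1 h)
    have hE' : a ∉ E := fun h => ha ((Finset.mem_powersetCard.1 hE).1 h)
    rw [← Finset.erase_insert hD', ← Finset.erase_insert hE', h]
  · rw [Finset.disjoint_left]
    intro D hD hD'
    obtain ⟨E, -, rfl⟩ := Finset.mem_image.1 hD'
    exact ha ((Finset.mem_powersetCard.1 hD).1 (Finset.mem_insert_self _ _))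

/-- Bonferroni inequalities for products of numbers in the unit interval. -/
theorem neg_one_pow_mul_prod_sub_truncSum_nonneg {ι : Type*} [DecidableEq ι] {t : ι → ℝ}
    (s : Finset ι) (h0 : ∀ i ∈ s, 0 ≤ t i) (h1 : ∀ i ∈ s, t i ≤ 1) (k : ℕ) :
    0 ≤ (-1) ^ k * (∏ i ∈ s, (1 - t i) - truncSum t s k) := by
  induction s using Finset.induction_on generalizing k with
  | empty =>
    rcases k with _ | k
    · simp [truncSum]
    · simp only [truncSum, Finset.prod_empty]
      rw [Finset.sum_range_succ', Finset.sum_eq_zero]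
      · simp
      · intro j _
        rw [Finset.powersetCard_eq_empty.2 (by simp)]
        simp
  | insert a s ha ih =>
    have h0' : ∀ i ∈ s, 0 ≤ t i := fun i hi => h0 i (Finset.mem_insert_of_mem hi)
    have h1' : ∀ i ∈ s, t i ≤ 1 := fun i hi => h1 i (Finset.mem_insert_of_mem hi)
    rcases k with _ | k
    · simp only [truncSum, Finset.range_zero, Finset.sum_empty, sub_zero, pow_zero, one_mul]
      exact Finset.prod_nonneg fun i hi => by linarith [h1 i hi]
    · rw [truncSum_insert t ha, Finset.prod_insert ha]
      have e1 := ih h0' h1' (k + 1)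
      have e2 := mul_nonneg (h0 a (Finset.mem_insert_self _ _)) (ih h0' h1' k)
      have := add_nonneg e1 e2
      refine this.trans_eq ?_
      ring

theorem prod_le_truncSum {ι : Type*} [DecidableEq ι] {t : ι → ℝ}
    (s : Finset ι) (h0 : ∀ i ∈ s, 0 ≤ t i) (h1 : ∀ i ∈ s, t i ≤ 1) {k : ℕ} (hk : Odd k) :
    ∏ i ∈ s, (1 - t i) ≤ truncSum t s k := by
  have := neg_one_pow_mul_prod_sub_truncSum_nonneg s h0 h1 k
  rw [hk.neg_one_pow] at this
  linarith

theorem sum_powersetCard_prod_nonneg {ι : Type*} {t : ι → ℝ} (s : Finset ι)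
    (h0 : ∀ i ∈ s, 0 ≤ t i) (j : ℕ) : 0 ≤ ∑ D ∈ s.powersetCard j, ∏ i ∈ D, t i :=
  Finset.sum_nonneg fun _ hD => Finset.prod_nonneg fun i hi =>
    h0 i ((Finset.mem_powersetCard.1 hD).1 hi)

theorem sum_range_pow_mul_powersetCard_le {ι : Type*} [DecidableEq ι] {t : ι → ℝ}
    (s : Finset ι) (h0 : ∀ i ∈ s, 0 ≤ t i) {x : ℝ} (hx : 0 ≤ x) (k : ℕ) :
    ∑ j ∈ Finset.range k, x ^ j * ∑ D ∈ s.powersetCard j, ∏ i ∈ D, t i ≤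
      exp (x * ∑ i ∈ s, t i) := by
  have h1 : ∏ i ∈ s, (1 + x * t i) ≤ exp (x * ∑ i ∈ s, t i) := by
    rw [Finset.mul_sum, exp_sum]
    exact Finset.prod_le_prod (fun i hi => by have := h0 i hi; positivity)
      fun i _ => by linarith [add_one_le_exp (x * t i)]
  refine le_trans ?_ h1
  have hterm : ∀ j, x ^ j * ∑ D ∈ s.powersetCard j, ∏ i ∈ D, t i =
      ∑ D ∈ s.powersetCard j, ∏ i ∈ D, (x * t i) := fun j => by
    rw [Finset.mul_sum]
    refine Finset.sum_congr rfl fun D hD => ?_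
    rw [Finset.prod_mul_distrib, Finset.prod_const, (Finset.mem_powersetCard.1 hD).2]
  simp_rw [hterm]
  have hnn := fun j => sum_powersetCard_prod_nonneg (t := fun i => x * t i) s
    (fun i hi => mul_nonneg hx (h0 i hi)) j
  rw [Finset.prod_one_add, Finset.sum_powerset]
  calc _ ≤ ∑ j ∈ Finset.range (max k (s.card + 1)),
        ∑ D ∈ s.powersetCard j, ∏ i ∈ D, (x * t i) :=
        Finset.sum_le_sum_of_subset_of_nonneg (Finset.range_mono (le_max_left _ _))
          fun j _ _ => hnn j
    _ = _ := by
        symm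
        refine Finset.sum_subset (Finset.range_mono (le_max_right _ _)) fun j _ hj => ?_
        rw [Finset.powersetCard_eq_empty.2 (by simpa using hj), Finset.sum_empty]

theorem truncSum_le {ι : Type*} [DecidableEq ι] {t : ι → ℝ}
    (s : Finset ι) (h0 : ∀ i ∈ s, 0 ≤ t i) (h1 : ∀ i ∈ s, t i ≤ 1) {k : ℕ} (hk : Odd k) :
    truncSum t s k ≤ exp (-∑ i ∈ s, t i) + exp (3 * ∑ i ∈ s, t i - k) := by
  have e1 := neg_one_pow_mul_prod_sub_truncSum_nonneg s h0 h1 (k + 1)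
  rw [hk.add_one.neg_one_pow, one_mul, truncSum, Finset.sum_range_succ, hk.neg_one_pow] at e1
  have e2 : ∏ i ∈ s, (1 - t i) ≤ exp (-∑ i ∈ s, t i) := by
    rw [← Finset.sum_neg_distrib, exp_sum]
    exact Finset.prod_le_prod (fun i hi => by linarith [h1 i hi])
      fun i _ => by linarith [add_one_le_exp (-t i)]
  have e3 : ∑ D ∈ s.powersetCard k, ∏ i ∈ D, t i ≤ exp (3 * ∑ i ∈ s, t i - k) := by
    have h := sum_range_pow_mul_powersetCard_le s h0 (exp_pos 1).le (k + 1)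
    rw [Finset.sum_range_succ] at h
    have h' : 0 ≤ ∑ j ∈ Finset.range k, exp 1 ^ j * ∑ D ∈ s.powersetCard j, ∏ i ∈ D, t i :=
      Finset.sum_nonneg fun j _ => mul_nonneg (by positivity) (sum_powersetCard_prod_nonneg s h0 j)
    rw [exp_sub, le_div_iff₀ (exp_pos _)]
    have h3 : exp (exp 1 * ∑ i ∈ s, t i) ≤ exp (3 * ∑ i ∈ s, t i) := by
      have := Finset.sum_nonneg h0
      have := exp_one_lt_d9
      gcongr
      linarith
    rw [← exp_nat_mul, mul_one] at h
    linarith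
  unfold truncSum
  linarith

theorem abs_card_filter_modEq_sub_le (X m r : ℕ) (hm : 0 < m) :
    |(((Finset.range X).filter (· ≡ r [MOD m])).card : ℝ) - X / m| ≤ 1 := by
  have hm' : (0 : ℝ) < m := by exact_mod_cast hm
  rw [← Nat.count_eq_card_filter_range, Nat.count_modEq_card _ hm]
  have h1 : (X : ℝ) / m = (X / m : ℕ) + (X % m : ℕ) / (m : ℝ) := by
    field_simp
    exact_mod_cast (Nat.div_add_mod X m).symm
  have h2 : ((X % m : ℕ) : ℝ) / m ≤ 1 := by
    rw [div_le_one hm']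
    exact_mod_cast (Nat.mod_lt X hm).le
  have h3 : (0 : ℝ) ≤ ((X % m : ℕ) : ℝ) / m := by positivity
  rw [h1, abs_le]
  push_cast
  split_ifs <;> constructor <;> linarith

/-- A product of weights, each periodic modulo a prime, is equidistributed in progressions. -/
theorem abs_sum_filter_modEq_prod_sub_le {w : ℕ → ℕ → ℝ} (hw0 : ∀ p b, 0 ≤ w p b)
    (hper : ∀ p b, w p (b % p) = w p b) (X : ℕ) (D : Finset ℕ) (hD : ∀ p ∈ D, p.Prime)
    (m : ℕ) (hm : 0 < m) (hcop : ∀ p ∈ D, m.Coprime p) (r : ℕ) :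
    |∑ b ∈ Finset.range X with b ≡ r [MOD m], ∏ p ∈ D, w p b -
      X / m * ∏ p ∈ D, (∑ c ∈ Finset.range p, w p c) / p| ≤
        ∏ p ∈ D, ∑ c ∈ Finset.range p, w p c := by
  induction D using Finset.induction_on generalizing m r with
  | empty => simpa using abs_card_filter_modEq_sub_le X m r hm
  | insert p D hp ih =>
    have hpp : p.Prime := hD p (Finset.mem_insert_self _ _)
    have hmp : m.Coprime p := hcop p (Finset.mem_insert_self _ _)
    have hD' : ∀ q ∈ D, q.Prime := fun q hq => hD q (Finset.mem_insert_of_mem hq)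
    have hcop' : ∀ q ∈ D, (m * p).Coprime q := fun q hq =>
      Nat.Coprime.mul_left (hcop q (Finset.mem_insert_of_mem hq))
        ((Nat.coprime_primes hpp (hD' q hq)).2 (by rintro rfl; exact hp hq))
    set x : ℕ → ℕ := fun c => Nat.chineseRemainder hmp r c with hx
    have key : ∑ b ∈ Finset.range X with b ≡ r [MOD m], ∏ q ∈ insert p D, w q b =
        ∑ c ∈ Finset.range p, w p c *
          ∑ b ∈ Finset.range X with b ≡ x c [MOD m * p], ∏ q ∈ D, w q b := by
      rw [← Finset.sum_fiberwise_of_maps_to (g := fun b => b % p) (t := Finset.range p)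
        fun b _ => Finset.mem_range.2 (Nat.mod_lt _ hpp.pos)]
      refine Finset.sum_congr rfl fun c hc => ?_
      rw [Finset.filter_filter, Finset.mul_sum]
      have hcp : c % p = c := Nat.mod_eq_of_lt (Finset.mem_range.1 hc)
      have hset : (Finset.range X).filter (fun b => b ≡ r [MOD m] ∧ b % p = c) =
          (Finset.range X).filter (fun b => b ≡ x c [MOD m * p]) := by
        refine Finset.filter_congr fun b _ => ?_
        rw [← Nat.modEq_and_modEq_iff_modEq_mul hmp]
        have h1 := (Nat.chineseRemainder hmp r c).2.1
        have h2 := (Nat.chineseRemainder hmp r c).2.2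
        constructor
        · rintro ⟨h, h'⟩
          refine ⟨h.trans h1.symm, Nat.ModEq.trans ?_ h2.symm⟩
          rw [Nat.ModEq, h', hcp]
        · rintro ⟨h, h'⟩
          refine ⟨h.trans h1, ?_⟩
          have := h'.trans h2
          rwa [Nat.ModEq, hcp] at this
      rw [← hset]
      refine Finset.sum_congr rfl fun b hb => ?_
      rw [Finset.prod_insert hp, ← hper p b, (Finset.mem_filter.1 hb).2.2]
    rw [key, Finset.prod_insert hp, Finset.prod_insert hp]
    have hp0 : (p : ℝ) ≠ 0 := by exact_mod_cast hpp.ne_zero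
    have hm0 : (m : ℝ) ≠ 0 := by exact_mod_cast hm.ne'
    have split : ∑ c ∈ Finset.range p, w p c *
          ∑ b ∈ Finset.range X with b ≡ x c [MOD m * p], ∏ q ∈ D, w q b -
        X / m * ((∑ c ∈ Finset.range p, w p c) / p *
          ∏ q ∈ D, (∑ c ∈ Finset.range q, w q c) / q) =
        ∑ c ∈ Finset.range p, w p c *
          (∑ b ∈ Finset.range X with b ≡ x c [MOD m * p], ∏ q ∈ D, w q b -
            X / (m * p : ℕ) * ∏ q ∈ D, (∑ c ∈ Finset.range q, w q c) / q) := by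
      simp_rw [mul_sub]
      rw [Finset.sum_sub_distrib, ← Finset.sum_mul]
      congr 1
      push_cast
      field_simp
    rw [split, Finset.sum_mul]
    refine (Finset.abs_sum_le_sum_abs _ _).trans (Finset.sum_le_sum fun c _ => ?_)
    rw [abs_mul, abs_of_nonneg (hw0 p c)]
    exact mul_le_mul_of_nonneg_left (ih hD' (m * p) (Nat.mul_pos hm hpp.pos) hcop' (x c))
      (hw0 p c)

theorem abs_sum_range_prod_sub_le {w : ℕ → ℕ → ℝ} (hw0 : ∀ p b, 0 ≤ w p b)
    (hper : ∀ p b, w p (b % p) = w p b) (X : ℕ) (D : Finset ℕ) (hD : ∀ p ∈ D, p.Prime) :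
    |∑ b ∈ Finset.range X, ∏ p ∈ D, w p b -
      X * ∏ p ∈ D, (∑ c ∈ Finset.range p, w p c) / p| ≤
        ∏ p ∈ D, ∑ c ∈ Finset.range p, w p c := by
  have := abs_sum_filter_modEq_prod_sub_le hw0 hper X D hD 1 one_pos (by simp) 0
  simpa [Nat.modEq_one] using this

/-- Brun's pure sieve with fractional weights. -/
theorem sum_range_prod_one_sub_le {w : ℕ → ℕ → ℝ} (hw0 : ∀ p b, 0 ≤ w p b)
    (hper : ∀ p b, w p (b % p) = w p b) (P : Finset ℕ) (hP : ∀ p ∈ P, p.Prime)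
    (hw1 : ∀ p ∈ P, ∀ b, w p b ≤ 1) {A : ℝ} (hA0 : 0 ≤ A)
    (hA : ∀ p ∈ P, ∑ c ∈ Finset.range p, w p c ≤ A)
    {Y : ℝ} (hY : 1 ≤ Y) (hPY : (P.card : ℝ) ≤ Y) (X : ℕ) {k : ℕ} (hk : Odd k) :
    ∑ b ∈ Finset.range X, ∏ p ∈ P, (1 - w p b) ≤
      X * (exp (-∑ p ∈ P, (∑ c ∈ Finset.range p, w p c) / p) +
        exp (3 * ∑ p ∈ P, (∑ c ∈ Finset.range p, w p c) / p - k)) + exp A * Y ^ k := by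
  set W : ℕ → ℝ := fun p => ∑ c ∈ Finset.range p, w p c with hW
  have hW0 : ∀ p, 0 ≤ W p := fun p => Finset.sum_nonneg fun c _ => hw0 p c
  have hWp : ∀ p ∈ P, W p / p ≤ 1 := fun p hp => by
    rw [div_le_one (by exact_mod_cast (hP p hp).pos)]
    calc W p ≤ ∑ c ∈ Finset.range p, (1 : ℝ) := Finset.sum_le_sum fun c _ => hw1 p hp c
      _ = p := by simp
  have h1 : ∑ b ∈ Finset.range X, ∏ p ∈ P, (1 - w p b) ≤
      ∑ b ∈ Finset.range X, truncSum (fun p => w p b) P k :=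
    Finset.sum_le_sum fun b _ => prod_le_truncSum P (fun p _ => hw0 p b)
      (fun p hp => hw1 p hp b) hk
  have h2 : ∑ b ∈ Finset.range X, truncSum (fun p => w p b) P k ≤
      X * truncSum (fun p => W p / p) P k +
        ∑ j ∈ Finset.range k, ∑ D ∈ P.powersetCard j, ∏ p ∈ D, W p := by
    unfold truncSum
    rw [Finset.sum_comm, Finset.mul_sum, ← Finset.sum_add_distrib]
    refine Finset.sum_le_sum fun j _ => ?_
    rw [← Finset.mul_sum, Finset.sum_comm, mul_left_comm, ← sub_le_iff_le_add', ← mul_sub,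
      Finset.mul_sum, ← Finset.sum_sub_distrib]
    refine (le_abs_self _).trans ?_
    rw [abs_mul, abs_neg_one_pow, one_mul]
    refine (Finset.abs_sum_le_sum_abs _ _).trans (Finset.sum_le_sum fun D hD => ?_)
    exact abs_sum_range_prod_sub_le hw0 hper X D
      fun p hp => hP p ((Finset.mem_powersetCard.1 hD).1 hp)
  have h3 : ∑ j ∈ Finset.range k, ∑ D ∈ P.powersetCard j, ∏ p ∈ D, W p ≤ exp A * Y ^ k := by
    have hY0 : 0 < Y := by linarith
    have e := sum_range_pow_mul_powersetCard_le (t := W) P (fun p _ => hW0 p)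
      (x := Y⁻¹) (by positivity) k
    have e1 : Y⁻¹ * ∑ p ∈ P, W p ≤ A := by
      rw [inv_mul_le_iff₀ hY0]
      calc ∑ p ∈ P, W p ≤ ∑ p ∈ P, A := Finset.sum_le_sum hA
        _ = P.card * A := by simp
        _ ≤ Y * A := by gcongr
    have e2 : (∑ j ∈ Finset.range k, ∑ D ∈ P.powersetCard j, ∏ p ∈ D, W p) / Y ^ k ≤
        ∑ j ∈ Finset.range k, Y⁻¹ ^ j * ∑ D ∈ P.powersetCard j, ∏ p ∈ D, W p := by
      rw [Finset.sum_div]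
      refine Finset.sum_le_sum fun j hj => ?_
      rw [div_eq_inv_mul, inv_pow]
      refine mul_le_mul_of_nonneg_right ?_ (sum_powersetCard_prod_nonneg P (fun p _ => hW0 p) j)
      have := (Finset.mem_range.1 hj).le
      gcongr
    rw [← div_le_iff₀ (by positivity)]
    exact e2.trans (e.trans (exp_le_exp.2 e1))
  have h4 := truncSum_le (t := fun p => W p / p) P (fun p _ => div_nonneg (hW0 p) (by positivity))
    hWp hk
  have h5 := mul_le_mul_of_nonneg_left h4 (Nat.cast_nonneg (α := ℝ) X)
  linarith

theorem card_filter_dvd_sq_add_sq {p a : ℕ} (hp : p.Prime) (hp2 : p ≠ 2) (ha : ¬ p ∣ a) :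
    (((Finset.range p).filter (fun c => p ∣ a ^ 2 + c ^ 2)).card : ℝ) = 1 + (χ₄ p : ℝ) := by
  have := Fact.mk hp
  have h := legendreSym.card_sqrts p hp2 (-(a : ℤ) ^ 2)
  have ha' : ((a : ℤ) : ZMod p) ≠ 0 := by
    rw [Int.cast_natCast]
    exact fun h => ha ((ZMod.natCast_eq_zero_iff a p).1 h)
  rw [legendreSym.at_neg hp2, legendreSym.sq_one' p ha', mul_one] at h
  rw [add_comm, ← Int.cast_one (R := ℝ), ← Int.cast_add, ← h, Int.cast_natCast]
  congr 1
  refine Finset.card_nbij' (fun c => (c : ZMod p)) (fun x => x.val) ?_ ?_ ?_ ?_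
  · intro c hc
    have := (ZMod.natCast_eq_zero_iff _ p).2 (Finset.mem_filter.1 hc).2
    push_cast at this
    simp only [Set.coe_toFinset, Set.mem_ofPred_eq]
    push_cast
    linear_combination this
  · intro x hx
    simp only [Set.coe_toFinset, Set.mem_ofPred_eq] at hx
    push_cast at hx
    simp only [Finset.coe_filter, Finset.mem_range, Set.mem_ofPred_eq]
    refine ⟨ZMod.val_lt x, ?_⟩
    rw [← ZMod.natCast_eq_zero_iff]
    push_cast
    rw [ZMod.natCast_val, ZMod.cast_id', id, hx]
    ring
  · intro c hc
    exact ZMod.val_natCast_of_lt (Finset.mem_range.1 (Finset.mem_filter.1 hc).1)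
  · intro x _
    simp

/-- The weight at `p` which detects `p ∣ a² + b²` and, with mass `1 - z`, `p ∣ b`. -/
noncomputable def sieveWeight (z : ℝ) (a p b : ℕ) : ℝ :=
  (1 - z) * (if p ∣ b then 1 else 0) + (if p ∣ a ^ 2 + b ^ 2 then 1 else 0)

theorem sieveWeight_nonneg {z : ℝ} (hz : z ≤ 1) (a p b : ℕ) : 0 ≤ sieveWeight z a p b := by
  unfold sieveWeight
  have : 0 ≤ 1 - z := by linarith
  positivity

theorem sieveWeight_mod (z : ℝ) (a p b : ℕ) :
    sieveWeight z a p (b % p) = sieveWeight z a p b := by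
  have h1 : p ∣ b % p ↔ p ∣ b := Nat.dvd_mod_iff dvd_rfl
  have h2 : p ∣ a ^ 2 + (b % p) ^ 2 ↔ p ∣ a ^ 2 + b ^ 2 :=
    (((Nat.mod_modEq b p).pow 2).add_left (a ^ 2)).dvd_iff dvd_rfl
  simp only [sieveWeight, h1, h2]

theorem sieveWeight_of_dvd {z : ℝ} {a p b : ℕ} (hp : p.Prime) (ha : ¬ p ∣ a) (hb : p ∣ b) :
    sieveWeight z a p b = 1 - z := by
  have : ¬ p ∣ a ^ 2 + b ^ 2 := fun h =>
    ha (hp.dvd_of_dvd_pow ((Nat.dvd_add_left (dvd_pow hb two_ne_zero)).1 h))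
  simp [sieveWeight, hb, this]

theorem sieveWeight_le_one {z : ℝ} (hz : 0 ≤ z) {a p : ℕ} (hp : p.Prime) (ha : ¬ p ∣ a)
    (b : ℕ) : sieveWeight z a p b ≤ 1 := by
  by_cases hb : p ∣ b
  · rw [sieveWeight_of_dvd hp ha hb]
    linarith
  · simp only [sieveWeight, hb, if_false, mul_zero, zero_add]
    split_ifs <;> norm_num

theorem sum_sieveWeight (z : ℝ) {a p : ℕ} (hp : p.Prime) (hp2 : p ≠ 2) (ha : ¬ p ∣ a) :
    ∑ c ∈ Finset.range p, sieveWeight z a p c = 2 - z + (χ₄ p : ℝ) := by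
  simp only [sieveWeight, Finset.sum_add_distrib, ← Finset.mul_sum, Finset.sum_boole]
  rw [card_filter_dvd_sq_add_sq hp hp2 ha]
  have : (Finset.range p).filter (fun c => p ∣ c) = {0} := by
    ext c
    simp only [Finset.mem_filter, Finset.mem_range, Finset.mem_singleton]
    constructor
    · rintro ⟨h, h'⟩
      exact Nat.eq_zero_of_dvd_of_lt h' h
    · rintro rfl
      exact ⟨hp.pos, dvd_zero p⟩
  rw [this]
  simp
  ring

/-- The primes in `(H, Y]` which do not divide `a`. -/
def sievePrimes (a H Y : ℕ) : Finset ℕ := Y.primesLE.filter fun p => H < p ∧ ¬ p ∣ a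

theorem χ₄_abs_le (p : ℕ) : |(ZMod.χ₄ p : ℝ)| ≤ 1 := by
  rcases χ₄_cases p with h | h | h <;> rw [h] <;> norm_num

theorem exists_le_sum_sievePrimes {z : ℝ} (hz0 : 0 ≤ z) (hz1 : z ≤ 1) :
    ∃ C : ℝ, 0 ≤ C ∧ ∀ a H Y : ℕ, a ≠ 0 → 2 ≤ H → 2 ≤ Y → a.primeFactors.card ≤ 2 * H →
      (2 - z) * log (log Y) - 3 * log (log H) - C ≤
        ∑ p ∈ sievePrimes a H Y, (2 - z + (χ₄ p : ℝ)) / p := by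
  obtain ⟨c, hc, hS⟩ := sum_inv_primesLE_le
  refine ⟨17 + 3 * c + 6, by positivity, fun a H Y ha hH hY hcard => ?_⟩
  set g : ℕ → ℝ := fun p => (2 - z + (χ₄ p : ℝ)) / p
  have hχ := fun p => abs_le.1 (χ₄_abs_le p)
  have hg0 : ∀ p, 0 ≤ g p := fun p => div_nonneg (by linarith [(hχ p).1]) (by positivity)
  have hg3 : ∀ p, g p ≤ 3 * (p : ℝ)⁻¹ := fun p => by
    simp only [g, div_eq_mul_inv]
    gcongr
    linarith [(hχ p).2]
  have hlow : (2 - z) * log (log Y) - 17 ≤ ∑ p ∈ Y.primesLE, g p := by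
    have e1 := loglog_le_sum_inv_primesLE Y hY
    have e2 := loglog_le_sum_one_add_χ₄_div_primesLE Y hY
    have : ∑ p ∈ Y.primesLE, g p = (1 - z) * ∑ p ∈ Y.primesLE, (p : ℝ)⁻¹ +
        ∑ p ∈ Y.primesLE, (1 + (χ₄ p : ℝ)) / p := by
      rw [Finset.mul_sum, ← Finset.sum_add_distrib]
      refine Finset.sum_congr rfl fun p _ => ?_
      simp only [g]
      ring
    rw [this]
    nlinarith
  have hsub : Y.primesLE ⊆ sievePrimes a H Y ∪ (H.primesLE ∪ a.primeFactors.filter (H < ·)) := by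
    intro p hp
    have hpp := Nat.prime_of_mem_primesLE hp
    simp only [sievePrimes, Finset.mem_union, Finset.mem_filter, hp, true_and, Nat.mem_primesLE,
      Nat.mem_primeFactors, hpp, and_true]
    by_cases hpa : p ∣ a <;> rcases Nat.lt_or_ge H p with h | h <;> simp [hpa, h, ha]
  have hunion : ∀ s t : Finset ℕ, ∑ p ∈ s ∪ t, g p ≤ ∑ p ∈ s, g p + ∑ p ∈ t, g p := fun s t => by
    rw [← Finset.sum_union_inter]
    linarith [Finset.sum_nonneg fun p (_ : p ∈ s ∩ t) => hg0 p]
  have h1 : ∑ p ∈ Y.primesLE, g p ≤ ∑ p ∈ sievePrimes a H Y, g p +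
      (∑ p ∈ H.primesLE, g p + ∑ p ∈ a.primeFactors.filter (H < ·), g p) :=
    (Finset.sum_le_sum_of_subset_of_nonneg hsub fun p _ _ => hg0 p).trans
      ((hunion _ _).trans (by gcongr; exact hunion _ _))
  have h2 : ∑ p ∈ H.primesLE, g p ≤ 3 * log (log H) + 3 * c := by
    have : ∑ p ∈ H.primesLE, g p ≤ 3 * ∑ p ∈ H.primesLE, (p : ℝ)⁻¹ := by
      rw [Finset.mul_sum]
      exact Finset.sum_le_sum fun p _ => hg3 p
    linarith [hS H hH]
  have h3 : ∑ p ∈ a.primeFactors.filter (H < ·), g p ≤ 6 := by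
    have hH0 : (0 : ℝ) < H := by positivity
    calc ∑ p ∈ a.primeFactors.filter (H < ·), g p
        ≤ ∑ p ∈ a.primeFactors.filter (H < ·), 3 * (H : ℝ)⁻¹ := by
          refine Finset.sum_le_sum fun p hp => (hg3 p).trans ?_
          have : (H : ℝ) ≤ p := by exact_mod_cast (Finset.mem_filter.1 hp).2.le
          gcongr
      _ = (a.primeFactors.filter (H < ·)).card * (3 * (H : ℝ)⁻¹) := by simp
      _ ≤ (2 * H) * (3 * (H : ℝ)⁻¹) := by
          gcongr
          exact_mod_cast (Finset.card_filter_le _ _).trans hcard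
      _ = 6 := by field_simp; norm_num
  change _ ≤ ∑ p ∈ sievePrimes a H Y, g p
  linarith

theorem sum_pow_card_primeFactors_prime_sq_add_sq_le {z : ℝ} (hz0 : 0 ≤ z) (hz1 : z ≤ 1) :
    ∃ C : ℝ, 0 ≤ C ∧ ∀ a H Y X k : ℕ, a ≠ 0 → 2 ≤ H → 2 ≤ Y → a.primeFactors.card ≤ 2 * H →
      Odd k → 12 * log (log Y) + C ≤ k →
      ∑ b ∈ Finset.range X with 0 < b ∧ (a ^ 2 + b ^ 2).Prime, z ^ b.primeFactors.card ≤
        2 * X * exp (-((2 - z) * log (log Y) - 3 * log (log H) - C)) + exp 3 * (Y : ℝ) ^ k +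
          (Y + 1) := by
  obtain ⟨c, hc, hS⟩ := sum_inv_primesLE_le
  obtain ⟨C₁, hC₁, hlow⟩ := exists_le_sum_sievePrimes hz0 hz1
  refine ⟨12 * c + C₁, by positivity, fun a H Y X k ha hH hY hcard hk hkY => ?_⟩
  set P := sievePrimes a H Y
  set w := sieveWeight z a
  have hmem : ∀ p ∈ P, p.Prime ∧ p ≤ Y ∧ p ≠ 2 ∧ ¬ p ∣ a := fun p hp => by
    obtain ⟨h1, h2, h3⟩ := Finset.mem_filter.1 hp
    exact ⟨Nat.prime_of_mem_primesLE h1, Nat.le_of_mem_primesLE h1, by omega, h3⟩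
  have hW : ∀ p ∈ P, ∑ c ∈ Finset.range p, w p c = 2 - z + (ZMod.χ₄ p : ℝ) := fun p hp =>
    sum_sieveWeight z (hmem p hp).1 (hmem p hp).2.2.1 (hmem p hp).2.2.2
  have hχ := fun p => abs_le.1 (χ₄_abs_le p)
  have hPY : (P.card : ℝ) ≤ Y := by
    have h : P ⊆ Finset.Ioc 0 Y := fun p hp =>
      Finset.mem_Ioc.2 ⟨(hmem p hp).1.pos, (hmem p hp).2.1⟩
    exact_mod_cast (Finset.card_le_card h).trans (by simp)
  have hsieve := sum_range_prod_one_sub_le (w := w) (sieveWeight_nonneg hz1 a)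
    (sieveWeight_mod z a) P (fun p hp => (hmem p hp).1)
    (fun p hp b => sieveWeight_le_one hz0 (hmem p hp).1 (hmem p hp).2.2.2 b)
    (A := 3) (by norm_num) (fun p hp => by rw [hW p hp]; linarith [(hχ p).2])
    (Y := Y) (by exact_mod_cast (by omega)) hPY X hk
  set S := ∑ p ∈ P, (2 - z + (ZMod.χ₄ p : ℝ)) / p
  have hWS : ∑ p ∈ P, (∑ c ∈ Finset.range p, w p c) / p = S :=
    Finset.sum_congr rfl fun p hp => by rw [hW p hp]
  rw [hWS] at hsieve
  have hSlow : (2 - z) * log (log Y) - 3 * log (log H) - C₁ ≤ S := hlow a H Y ha hH hY hcard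
  have hSup : S ≤ 3 * log (log Y) + 3 * c := by
    have e1 : S ≤ ∑ p ∈ P, 3 * (p : ℝ)⁻¹ := by
      refine Finset.sum_le_sum fun p _ => ?_
      rw [div_eq_mul_inv]
      gcongr
      linarith [(hχ p).2]
    have e2 : ∑ p ∈ P, 3 * (p : ℝ)⁻¹ ≤ ∑ p ∈ Y.primesLE, 3 * (p : ℝ)⁻¹ :=
      Finset.sum_le_sum_of_subset_of_nonneg (Finset.filter_subset _ _) fun p _ _ => by positivity
    simp only [← Finset.mul_sum] at e1 e2
    linarith [hS Y hY]
  have hbound : (X : ℝ) * (exp (-S) + exp (3 * S - k)) ≤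
      2 * X * exp (-((2 - z) * log (log Y) - 3 * log (log H) - (12 * c + C₁))) := by
    have e1 : exp (-S) ≤ exp (-((2 - z) * log (log Y) - 3 * log (log H) - (12 * c + C₁))) :=
      exp_le_exp.2 (by linarith)
    have e2 : exp (3 * S - k) ≤ exp (-S) := exp_le_exp.2 (by linarith)
    nlinarith [Nat.cast_nonneg (α := ℝ) X]
  have hsplit : ∑ b ∈ Finset.range X with 0 < b ∧ (a ^ 2 + b ^ 2).Prime,
      z ^ b.primeFactors.card ≤
      ∑ b ∈ Finset.range X, ∏ p ∈ P, (1 - w p b) + ∑ b ∈ Finset.range (Y + 1), (1 : ℝ) := by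
    have hprod0 : ∀ b, 0 ≤ ∏ p ∈ P, (1 - w p b) := fun b => Finset.prod_nonneg fun p hp => by
      have : w p b ≤ 1 := sieveWeight_le_one hz0 (hmem p hp).1 (hmem p hp).2.2.2 b
      linarith
    set B := (Finset.range X).filter fun b => 0 < b ∧ (a ^ 2 + b ^ 2).Prime
    rw [← Finset.sum_filter_not_add_sum_filter B (fun b => b < Y + 1)]
    refine add_le_add ?_ ?_
    · refine (Finset.sum_le_sum fun b hb => ?_).trans
        (Finset.sum_le_sum_of_subset_of_nonneg
          ((Finset.filter_subset _ _).trans (Finset.filter_subset _ _)) fun b _ _ => hprod0 b)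
      obtain ⟨hb1, hb2⟩ := Finset.mem_filter.1 hb
      obtain ⟨-, hb0, hprime⟩ := Finset.mem_filter.1 hb1
      have hw : ∀ p ∈ P, 1 - w p b = if p ∣ b then z else 1 := fun p hp => by
        split_ifs with h
        · simp only [w]
          rw [sieveWeight_of_dvd (hmem p hp).1 (hmem p hp).2.2.2 h]
          ring
        · have : ¬ p ∣ a ^ 2 + b ^ 2 := fun h' => by
            rw [Nat.prime_dvd_prime_iff_eq (hmem p hp).1 hprime] at h'
            have := (hmem p hp).2.1
            nlinarith
          simp [w, sieveWeight, h, this]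
      rw [Finset.prod_congr rfl hw, Finset.prod_ite, Finset.prod_const, Finset.prod_const_one,
        mul_one]
      refine pow_le_pow_of_le_one hz0 hz1 (Finset.card_le_card fun p hp => ?_)
      obtain ⟨hp1, hp2⟩ := Finset.mem_filter.1 hp
      exact Nat.mem_primeFactors.2 ⟨(hmem p hp1).1, hp2, hb0.ne'⟩
    · refine (Finset.sum_le_sum fun b _ => pow_le_one₀ hz0 hz1).trans
        (Finset.sum_le_sum_of_subset_of_nonneg (fun b hb => ?_) fun _ _ _ => zero_le_one)
      exact Finset.mem_range.2 (Finset.mem_filter.1 hb).2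
  have hY1 : ∑ b ∈ Finset.range (Y + 1), (1 : ℝ) = Y + 1 := by simp
  linarith

theorem two_pow_card_primeFactors_le {a : ℕ} (ha : a ≠ 0) : 2 ^ a.primeFactors.card ≤ a :=
  (Finset.pow_card_le_prod _ _ _ fun _ hp => (Nat.prime_of_mem_primeFactors hp).two_le).trans
    (Nat.le_of_dvd (Nat.pos_of_ne_zero ha) (Nat.prod_primeFactors_dvd a))

theorem card_primeFactors_le_two_mul {a : ℕ} {x : ℝ} (ha : a ≠ 0) (hax : (a : ℝ) ≤ exp x) :
    (a.primeFactors.card : ℝ) ≤ 2 * x := by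
  have h : (2 : ℝ) ^ a.primeFactors.card ≤ exp x :=
    le_trans (by exact_mod_cast two_pow_card_primeFactors_le ha) hax
  have h2 := (log_le_iff_le_exp (by positivity)).2 h
  rw [log_pow] at h2
  have := log_two_gt_d9
  nlinarith [Nat.cast_nonneg (α := ℝ) a.primeFactors.card]

theorem exists_sieve_level {c : ℝ} (hc : 0 ≤ c) : ∃ x₀ : ℝ, 4 ≤ x₀ ∧ ∀ x ≥ x₀,
    1 ≤ log x ∧ ∃ k Y : ℕ, Odd k ∧ 2 ≤ Y ∧ 12 * log (log Y) + c ≤ k ∧ (Y : ℝ) ^ k ≤ exp (x / 4) ∧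
      (Y : ℝ) ≤ exp (x / 4) ∧ log x - log (log x) - log (8 * (15 + c)) ≤ log (log Y) := by
  have hlim := (isLittleO_log_id_atTop.def (c := (8 * (15 + c))⁻¹) (by positivity))
  obtain ⟨x₀, hx₀⟩ := Filter.eventually_atTop.1 hlim
  refine ⟨max x₀ 4, le_max_right _ _, fun x hx => ?_⟩
  have hx4 : 4 ≤ x := (le_max_right _ _).trans hx
  have hL1 : 1 ≤ log x := by
    rw [le_log_iff_exp_le (by linarith)]
    linarith [exp_one_lt_d9]
  have hxL : 8 * (15 + c) * log x ≤ x := by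
    have := hx₀ x ((le_max_left _ _).trans hx)
    rw [id, norm_of_nonneg (by linarith), norm_of_nonneg (by linarith), inv_mul_eq_div,
      le_div_iff₀ (by positivity)] at this
    linarith
  set L := log x
  set m := ⌈(12 * L + c) / 2⌉₊
  have hm1 : (12 * L + c) / 2 ≤ m := Nat.le_ceil _
  have hm2 : (m : ℝ) < (12 * L + c) / 2 + 1 := Nat.ceil_lt_add_one (by positivity)
  set k := 2 * m + 1 with hk
  have hkm : (k : ℝ) = 2 * m + 1 := by push_cast [hk]; ring
  have hk1 : (1 : ℝ) ≤ k := by rw [hkm]; linarith [Nat.cast_nonneg (α := ℝ) m]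
  have hkL : (k : ℝ) ≤ (15 + c) * L := by rw [hkm]; nlinarith
  set t := exp (x / (8 * k))
  have ht1 : 1 ≤ x / (8 * k) := by
    rw [le_div_iff₀ (by positivity)]
    linarith
  have ht : 2 ≤ t := by
    have := add_one_le_exp (x / (8 * k))
    linarith
  have htt : exp (x / (4 * k)) = t * t := by
    rw [← exp_add]
    congr 1
    field_simp
    norm_num
  have hYle : (⌊exp (x / (4 * k))⌋₊ : ℝ) ≤ exp (x / (4 * k)) := Nat.floor_le (exp_pos _).le
  have hYge : t ≤ ⌊exp (x / (4 * k))⌋₊ := by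
    have := Nat.lt_floor_add_one (exp (x / (4 * k)))
    rw [htt] at this ⊢
    nlinarith
  set Y := ⌊exp (x / (4 * k))⌋₊
  have hY0 : (0 : ℝ) < Y := by linarith
  have hlogY : x / (8 * k) ≤ log Y := by rwa [le_log_iff_exp_le hY0]
  have hlogY' : log Y ≤ x / (4 * k) := by rwa [log_le_iff_le_exp hY0]
  have hxk : x / (4 * k) ≤ x / 4 := by
    gcongr
    linarith
  refine ⟨hL1, k, Y, ⟨m, rfl⟩, by exact_mod_cast ht.trans hYge, ?_, ?_,
    hYle.trans (exp_le_exp.2 hxk), ?_⟩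
  · have : log (log Y) ≤ L := log_le_log (by linarith) (by linarith)
    linarith
  · calc (Y : ℝ) ^ k ≤ exp (x / (4 * k)) ^ k := by gcongr
      _ = exp (x / 4) := by
        rw [← exp_nat_mul]
        congr 1
        field_simp
  · rw [← log_div (by linarith) (by linarith), ← log_div (by positivity) (by positivity)]
    refine log_le_log (by positivity) (le_trans ?_ hlogY)
    rw [div_div]
    gcongr x / ?_
    linarith

theorem sum_pow_card_primeFactors_prime_sq_add_sq_le_of_le_exp {z : ℝ} (hz0 : 0 ≤ z)
    (hz1 : z ≤ 1) : ∃ C x₀ : ℝ, 0 ≤ C ∧ 4 ≤ x₀ ∧ ∀ x ≥ x₀, ∀ a X : ℕ, a ≠ 0 → (a : ℝ) ≤ exp x →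
      ∑ b ∈ Finset.range X with 0 < b ∧ (a ^ 2 + b ^ 2).Prime, z ^ b.primeFactors.card ≤
        C * (X * x ^ (z - 2) * log x ^ 5 + exp (x / 4)) := by
  obtain ⟨c, hc, hsum⟩ := sum_pow_card_primeFactors_prime_sq_add_sq_le hz0 hz1
  obtain ⟨x₀, hx₀, hpar⟩ := exists_sieve_level hc
  set D := log (8 * (15 + c))
  have hD : 0 ≤ D := log_nonneg (by linarith)
  refine ⟨2 * exp (2 * D + 3 + c) + exp 3 + 2, x₀, by positivity, hx₀,
    fun x hx a X ha hax => ?_⟩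
  obtain ⟨hL, k, Y, hk, hY, hkY, hYk, hYx, hYL⟩ := hpar x hx
  have hx4 := hx₀.trans hx
  have hx0 : 0 < x := by linarith
  set L := log x with hLdef
  have hlogL : 0 ≤ log L := log_nonneg hL
  have hxH : x ≤ ⌈x⌉₊ := Nat.le_ceil x
  have hHx : (⌈x⌉₊ : ℝ) < x + 1 := Nat.ceil_lt_add_one hx0.le
  set H := ⌈x⌉₊
  have hH2 : 2 ≤ H := by exact_mod_cast (by linarith : (2 : ℝ) ≤ H)
  have hcard : a.primeFactors.card ≤ 2 * H := by
    have := card_primeFactors_le_two_mul ha hax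
    exact_mod_cast (by linarith : (a.primeFactors.card : ℝ) ≤ 2 * H)
  have hHL : log (log H) ≤ 1 + log L := by
    have h1 : log H ≤ 2 * L := by
      rw [hLdef, ← log_rpow hx0, rpow_two]
      exact log_le_log (by linarith) (by nlinarith)
    have h2 : 0 < log H := log_pos (by linarith)
    calc log (log H) ≤ log (2 * L) := log_le_log h2 h1
      _ = log 2 + log L := log_mul two_ne_zero (by linarith)
      _ ≤ _ := by linarith [log_two_lt_d9]
  have hmain : exp (-((2 - z) * log (log Y) - 3 * log (log H) - c)) ≤
      exp (2 * D + 3 + c) * (x ^ (z - 2) * L ^ 5) := by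
    have e : x ^ (z - 2) * L ^ 5 = exp (L * (z - 2) + 5 * log L) := by
      rw [exp_add, ← rpow_def_of_pos hx0, mul_comm 5, ← rpow_def_of_pos (by linarith)]
      norm_cast
    rw [e, ← exp_add, exp_le_exp]
    nlinarith
  have hexp1 : 1 ≤ exp (x / 4) := one_le_exp (by positivity)
  have hB : 0 ≤ X * x ^ (z - 2) * L ^ 5 := by positivity
  calc _ ≤ 2 * X * exp (-((2 - z) * log (log Y) - 3 * log (log H) - c)) +
        exp 3 * (Y : ℝ) ^ k + (Y + 1) := hsum a H Y X k ha hH2 hY hcard hk hkY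
    _ ≤ 2 * X * (exp (2 * D + 3 + c) * (x ^ (z - 2) * L ^ 5)) + exp 3 * exp (x / 4) +
        (exp (x / 4) + exp (x / 4)) := by gcongr
    _ ≤ _ := by
      have := mul_nonneg (exp_pos (2 * D + 3 + c)).le (exp_pos (x / 4)).le
      have := mul_nonneg (exp_pos 3).le hB
      nlinarith

theorem card_filter_lt_card_primeFactors_le {y : ℝ} (hy : 1 ≤ y) : ∃ C : ℝ, 0 < C ∧
    ∀ n : ℕ, 2 ≤ n → ∀ t : ℝ,
      (((Finset.Ioc 0 n).filter fun k => t < k.primeFactors.card).card : ℝ) ≤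
        C * n * log n ^ (y - 1) * y ^ (-t) := by
  obtain ⟨C, hC, h⟩ := sum_pow_card_primeFactors_le hy
  refine ⟨C, hC, fun n hn t => ?_⟩
  have hy0 : 0 < y := by linarith
  calc (((Finset.Ioc 0 n).filter fun k => t < k.primeFactors.card).card : ℝ)
      = ∑ k ∈ (Finset.Ioc 0 n).filter (fun k => t < k.primeFactors.card), (1 : ℝ) := by simp
    _ ≤ ∑ k ∈ (Finset.Ioc 0 n).filter (fun k => t < k.primeFactors.card),
          y ^ k.primeFactors.card * y ^ (-t) := by
        refine Finset.sum_le_sum fun k hk => ?_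
        rw [← rpow_natCast, ← rpow_add hy0]
        exact one_le_rpow hy (by linarith [(Finset.mem_filter.1 hk).2])
    _ ≤ ∑ k ∈ Finset.Ioc 0 n, y ^ k.primeFactors.card * y ^ (-t) :=
        Finset.sum_le_sum_of_subset_of_nonneg (Finset.filter_subset _ _)
          fun k _ _ => by positivity
    _ ≤ _ := by
        rw [← Finset.sum_mul]
        gcongr
        exact h n hn

theorem coprime_of_prime_sq_add_sq {a b : ℕ} (h : (a ^ 2 + b ^ 2).Prime) : a.Coprime b := by
  have hd : a.gcd b ^ 2 ∣ a ^ 2 + b ^ 2 :=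
    dvd_add (pow_dvd_pow_of_dvd (Nat.gcd_dvd_left a b) 2)
      (pow_dvd_pow_of_dvd (Nat.gcd_dvd_right a b) 2)
  rcases (Nat.dvd_prime h).1 hd with h1 | h1
  · exact (Nat.pow_eq_one.1 h1).resolve_right two_ne_zero
  · rw [← h1] at h
    exact absurd h (Nat.Prime.not_prime_pow le_rfl)

theorem card_filter_exists_mul_eq_le {z : ℝ} (hz0 : 0 < z) (hz1 : z ≤ 1) (M : ℕ) (t : ℝ)
    {S : Finset ℕ} (hS : ∀ n ∈ S, 0 < n ∧ n ≤ M ∧ (n.primeFactors.card : ℝ) ≤ t ∧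
      ∃ a b : ℕ, n = a * b ∧ (a ^ 2 + b ^ 2).Prime) :
    (S.card : ℝ) ≤ z ^ (-t) * ∑ a ∈ Finset.Ioc 0 M.sqrt, z ^ a.primeFactors.card *
      ∑ b ∈ Finset.range (M / a + 1) with 0 < b ∧ (a ^ 2 + b ^ 2).Prime,
        z ^ b.primeFactors.card := by
  set U : Finset (Σ _ : ℕ, ℕ) := (Finset.Ioc 0 M.sqrt).sigma fun a =>
    (Finset.range (M / a + 1)).filter fun b => 0 < b ∧ (a ^ 2 + b ^ 2).Prime
  set V := U.filter fun s => (s.1.primeFactors.card : ℝ) + s.2.primeFactors.card ≤ t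
  have hSV : S ⊆ V.image fun s => s.1 * s.2 := fun n hn => by
    obtain ⟨hn0, hnM, hnt, a, b, rfl, hab⟩ := hS n hn
    have key : ∀ u v : ℕ, u ≤ v → (u ^ 2 + v ^ 2).Prime → u * v = a * b →
        a * b ∈ V.image fun s => s.1 * s.2 := fun u v huv hp he => by
      rw [← he] at hn0 hnM hnt ⊢
      have hu : 0 < u := Nat.pos_of_mul_pos_right hn0
      have hv : 0 < v := Nat.pos_of_mul_pos_left hn0
      refine Finset.mem_image.2 ⟨⟨u, v⟩, Finset.mem_filter.2 ⟨Finset.mem_sigma.2 ⟨?_, ?_⟩, ?_⟩, rfl⟩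
      · exact Finset.mem_Ioc.2 ⟨hu, Nat.le_sqrt.2 ((Nat.mul_le_mul_left u huv).trans hnM)⟩
      · refine Finset.mem_filter.2 ⟨Finset.mem_range.2 (Nat.lt_succ_of_le ?_), hv, hp⟩
        rw [Nat.le_div_iff_mul_le hu, mul_comm]
        exact hnM
      · rw [card_primeFactors_mul_of_coprime (coprime_of_prime_sq_add_sq hp)] at hnt
        exact_mod_cast hnt
    rcases le_total a b with h | h
    · exact key a b h hab rfl
    · exact key b a h (by rwa [add_comm]) (mul_comm b a)
  calc (S.card : ℝ) ≤ V.card := by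
        exact_mod_cast (Finset.card_le_card hSV).trans Finset.card_image_le
    _ = ∑ s ∈ V, (1 : ℝ) := by simp
    _ ≤ ∑ s ∈ V, z ^ (-t) * (z ^ s.1.primeFactors.card * z ^ s.2.primeFactors.card) := by
        refine Finset.sum_le_sum fun s hs => ?_
        rw [← rpow_natCast, ← rpow_natCast, ← rpow_add hz0, ← rpow_add hz0]
        exact one_le_rpow_of_pos_of_le_one_of_nonpos hz0 hz1
          (by linarith [(Finset.mem_filter.1 hs).2])
    _ ≤ ∑ s ∈ U, z ^ (-t) * (z ^ s.1.primeFactors.card * z ^ s.2.primeFactors.card) :=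
        Finset.sum_le_sum_of_subset_of_nonneg (Finset.filter_subset _ _)
          fun s _ _ => by positivity
    _ = _ := by
        rw [← Finset.mul_sum, Finset.sum_sigma]
        simp only [Finset.mul_sum]

theorem sum_sum_pow_card_primeFactors_le {z : ℝ} (hz0 : 0 < z) (hz1 : z ≤ 1) :
    ∃ C x₀ : ℝ, 0 ≤ C ∧ 4 ≤ x₀ ∧ ∀ x ≥ x₀, ∀ M : ℕ, 4 ≤ M → (M : ℝ) ≤ exp x →
      ∑ a ∈ Finset.Ioc 0 M.sqrt, z ^ a.primeFactors.card *
        ∑ b ∈ Finset.range (M / a + 1) with 0 < b ∧ (a ^ 2 + b ^ 2).Prime,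
          z ^ b.primeFactors.card ≤
      C * (exp x * x ^ (2 * z - 2) * log x ^ 5) := by
  obtain ⟨C₁, x₀, hC₁, hx₀, hin⟩ :=
    sum_pow_card_primeFactors_prime_sq_add_sq_le_of_le_exp hz0.le hz1
  obtain ⟨C₂, hC₂, hout⟩ := sum_pow_card_primeFactors_div_le hz0
  refine ⟨C₁ * 2 * C₂ + C₁ * 32, x₀, by positivity, hx₀, fun x hx M hM hMx => ?_⟩
  have hx4 := hx₀.trans hx
  have hx0 : 0 < x := by linarith
  have hL : 1 ≤ log x := by
    rw [le_log_iff_exp_le hx0]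
    linarith [exp_one_lt_d9]
  have hR2 : 2 ≤ M.sqrt := Nat.le_sqrt.2 hM
  have hRM : (M.sqrt : ℝ) ≤ exp (x / 2) := by
    refine le_of_sq_le_sq ?_ (exp_pos _).le
    rw [← exp_nat_mul]
    calc ((M.sqrt : ℝ)) ^ 2 ≤ M := by exact_mod_cast Nat.sqrt_le' M
      _ ≤ exp x := hMx
      _ = _ := by congr 1; push_cast; ring
  have hterm : ∀ a ∈ Finset.Ioc 0 M.sqrt, z ^ a.primeFactors.card *
      ∑ b ∈ Finset.range (M / a + 1) with 0 < b ∧ (a ^ 2 + b ^ 2).Prime,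
        z ^ b.primeFactors.card ≤ C₁ * 2 * exp x * x ^ (z - 2) * log x ^ 5 *
          (z ^ a.primeFactors.card / a) + C₁ * exp (x / 4) := fun a ha => by
    obtain ⟨ha0, haR⟩ := Finset.mem_Ioc.1 ha
    have ha0' : (0 : ℝ) < a := by exact_mod_cast ha0
    have haM : (a : ℝ) ≤ exp x :=
      le_trans (by exact_mod_cast haR.trans (Nat.sqrt_le_self M)) hMx
    have hX : ((M / a + 1 : ℕ) : ℝ) ≤ 2 * exp x / a := by
      push_cast
      have h1 : ((M / a : ℕ) : ℝ) ≤ exp x / a :=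
        Nat.cast_div_le.trans (by gcongr)
      have h2 : 1 ≤ exp x / a := (one_le_div ha0').2 haM
      rw [mul_div_assoc]
      linarith
    have hza : z ^ a.primeFactors.card ≤ 1 := pow_le_one₀ hz0.le hz1
    calc _ ≤ z ^ a.primeFactors.card * (C₁ * (2 * exp x / a * x ^ (z - 2) * log x ^ 5 +
          exp (x / 4))) := by
          gcongr
          refine (hin x hx a _ ha0.ne' haM).trans ?_
          gcongr
      _ = C₁ * 2 * exp x * x ^ (z - 2) * log x ^ 5 * (z ^ a.primeFactors.card / a) +
          z ^ a.primeFactors.card * (C₁ * exp (x / 4)) := by ring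
      _ ≤ _ := by
          exact add_le_add le_rfl (mul_le_of_le_one_left (by positivity) hza)
  have hsmall : exp (x / 2) * exp (x / 4) ≤ 32 * (exp x * x ^ (2 * z - 2) * log x ^ 5) := by
    have h1 : x ^ 2 ≤ 32 * exp (x / 4) := by
      nlinarith [quadratic_le_exp_of_nonneg (x := x / 4) (by positivity)]
    have h2 : x ^ (-2 : ℝ) ≤ x ^ (2 * z - 2) :=
      rpow_le_rpow_of_exponent_le (by linarith) (by linarith)
    rw [rpow_neg hx0.le, rpow_two] at h2
    have h3 : 1 ≤ log x ^ 5 := one_le_pow₀ hL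
    have h4 : exp x = exp (x / 2) * exp (x / 4) * exp (x / 4) := by
      rw [← exp_add, ← exp_add]
      congr 1
      ring
    calc exp (x / 2) * exp (x / 4) = exp (x / 2) * exp (x / 4) * x ^ 2 * (x ^ 2)⁻¹ := by
          field_simp
      _ ≤ exp (x / 2) * exp (x / 4) * (32 * exp (x / 4)) * (x ^ 2)⁻¹ := by gcongr
      _ = 32 * (exp x * (x ^ 2)⁻¹ * 1) := by
          rw [h4]
          ring
      _ ≤ _ := by gcongr
  have hmain : ∑ a ∈ Finset.Ioc 0 M.sqrt, z ^ a.primeFactors.card / a ≤ C₂ * x ^ z := by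
    refine (hout _ hR2).trans ?_
    have h0 : 0 ≤ log (M.sqrt : ℝ) := log_natCast_nonneg _
    have h1 : log (M.sqrt : ℝ) ≤ x / 2 :=
      (log_le_iff_le_exp (by positivity)).2 hRM
    gcongr
    linarith
  calc _ ≤ ∑ a ∈ Finset.Ioc 0 M.sqrt, (C₁ * 2 * exp x * x ^ (z - 2) * log x ^ 5 *
          (z ^ a.primeFactors.card / a) + C₁ * exp (x / 4)) := Finset.sum_le_sum hterm
    _ = C₁ * 2 * exp x * x ^ (z - 2) * log x ^ 5 *
          ∑ a ∈ Finset.Ioc 0 M.sqrt, z ^ a.primeFactors.card / a +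
          M.sqrt * (C₁ * exp (x / 4)) := by
        rw [Finset.sum_add_distrib, ← Finset.mul_sum]
        simp
    _ ≤ C₁ * 2 * exp x * x ^ (z - 2) * log x ^ 5 * (C₂ * x ^ z) +
          exp (x / 2) * (C₁ * exp (x / 4)) := by gcongr
    _ = C₁ * 2 * C₂ * (exp x * (x ^ (z - 2) * x ^ z) * log x ^ 5) +
          C₁ * (exp (x / 2) * exp (x / 4)) := by ring
    _ ≤ C₁ * 2 * C₂ * (exp x * x ^ (2 * z - 2) * log x ^ 5) +
          C₁ * (32 * (exp x * x ^ (2 * z - 2) * log x ^ 5)) := by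
        rw [← rpow_add hx0, show z - 2 + z = 2 * z - 2 by ring]
        gcongr
    _ = _ := by ring

theorem countC_le_add (N t : ℝ) : ∃ S : Finset ℕ, (∀ n ∈ S, 0 < n ∧ n ≤ ⌊N⌋₊ ∧
      (n.primeFactors.card : ℝ) ≤ t ∧ ∃ a b : ℕ, n = a * b ∧ (a ^ 2 + b ^ 2).Prime) ∧
    countC N ≤ ((Finset.Ioc 0 ⌊N⌋₊).filter fun n => t < n.primeFactors.card).card + S.card := by
  classical
  set T := (Finset.Ioc 0 ⌊N⌋₊).filter fun n => t < n.primeFactors.card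
  set S := (Finset.Ioc 0 ⌊N⌋₊).filter fun n => (n.primeFactors.card : ℝ) ≤ t ∧
    ∃ a b : ℕ, n = a * b ∧ (a ^ 2 + b ^ 2).Prime
  refine ⟨S, fun n hn => ?_, ?_⟩
  · obtain ⟨h1, h2⟩ := Finset.mem_filter.1 hn
    exact ⟨(Finset.mem_Ioc.1 h1).1, (Finset.mem_Ioc.1 h1).2, h2⟩
  · refine le_trans ?_ (Finset.card_union_le T S)
    rw [← Set.ncard_coe_finset]
    refine Set.ncard_le_ncard (fun n hn => ?_) (Finset.finite_toSet _)
    obtain ⟨h1, h2, a, b, -, -, h3, h4⟩ := hn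
    have hn : n ∈ Finset.Ioc 0 ⌊N⌋₊ := Finset.mem_Ioc.2 ⟨by omega, Nat.le_floor h2⟩
    rcases lt_or_ge t n.primeFactors.card with h | h
    · exact Finset.mem_union_left _ (Finset.mem_filter.2 ⟨hn, h⟩)
    · exact Finset.mem_union_right _ (Finset.mem_filter.2 ⟨hn, h, a, b, h3, h4⟩)

theorem countC_le {N : ℝ} (hN : 0 ≤ N) : (countC N : ℝ) ≤ N := by
  have : countC N ≤ (Finset.Ioc 0 ⌊N⌋₊).card := by
    rw [← Set.ncard_coe_finset]
    refine Set.ncard_le_ncard (fun n hn => ?_) (Finset.finite_toSet _)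
    exact Finset.mem_coe.2 (Finset.mem_Ioc.2 ⟨by have := hn.1; omega, Nat.le_floor hn.2.1⟩)
  rw [Nat.card_Ioc, Nat.sub_zero] at this
  exact le_trans (by exact_mod_cast this) (Nat.floor_le hN)

theorem rpow_neg_mul_log {c x : ℝ} (hc : 0 < c) (hx : 0 < x) (k : ℝ) :
    c ^ (-(k * log x)) = x ^ (-(k * log c)) := by
  rw [rpow_def_of_pos hc, rpow_def_of_pos hx]
  congr 1
  ring

theorem exists_countC_le_of_large : ∃ C x₀ : ℝ, 0 < C ∧ 4 ≤ x₀ ∧ ∀ N : ℝ, 16 ≤ N → x₀ ≤ log N →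
    (countC N : ℝ) ≤ C * N * log (log N) ^ 5 /
      log N ^ (1 - (1 + log (log 2)) / log 2) := by
  have hl2 : 0 < log 2 := log_pos one_lt_two
  have hl2' := log_two_lt_d9
  have hl2'' := log_two_gt_d9
  set η := 1 - (1 + log (log 2)) / log 2 with hη
  set κ := (log 2)⁻¹ with hκdef
  have hκ : 1 ≤ κ := (one_le_inv₀ hl2).2 (by linarith)
  have hκ0 : 0 < κ := by linarith
  have hκ2 : κ / 2 ≤ 1 := by
    have : κ ≤ 2 := inv_le_of_inv_le₀ two_pos (by linarith)
    linarith
  have hκl : κ * log 2 = 1 := inv_mul_cancel₀ hl2.ne'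
  have hlκ : log κ = -log (log 2) := log_inv _
  have hη' : κ - 1 - κ * log κ = -η := by
    rw [hη, hlκ, div_eq_mul_inv, ← hκdef]
    ring
  have hη'' : 2 * (κ / 2) - 2 - κ * log (κ / 2) = -η := by
    rw [log_div hκ0.ne' two_ne_zero, ← hη']
    linear_combination hκl
  obtain ⟨C₁, hC₁, hmany⟩ := card_filter_lt_card_primeFactors_le hκ
  obtain ⟨C₂, x₀, hC₂, hx₀, hfew⟩ := sum_sum_pow_card_primeFactors_le (half_pos hκ0) hκ2
  refine ⟨C₁ + C₂, x₀, by positivity, hx₀, fun N hN hx => ?_⟩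
  have hN0 : 0 < N := by linarith
  have hx0 : 0 < log N := by linarith
  have hL : 1 ≤ log (log N) := by
    rw [le_log_iff_exp_le hx0]
    linarith [exp_one_lt_d9]
  have hM : 4 ≤ ⌊N⌋₊ := Nat.le_floor (by push_cast; linarith)
  have hMN : (⌊N⌋₊ : ℝ) ≤ N := Nat.floor_le hN0.le
  obtain ⟨S, hS, hle⟩ := countC_le_add N (κ * log (log N))
  have h1 : (((Finset.Ioc 0 ⌊N⌋₊).filter fun n =>
      κ * log (log N) < n.primeFactors.card).card : ℝ) ≤ C₁ * (N * log N ^ (-η)) := by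
    refine (hmany _ (by omega) _).trans ?_
    rw [rpow_neg_mul_log hκ0 hx0]
    have hM0 : 0 ≤ log (⌊N⌋₊ : ℝ) := log_natCast_nonneg _
    have hMl : log (⌊N⌋₊ : ℝ) ≤ log N := log_le_log (by positivity) hMN
    calc C₁ * ⌊N⌋₊ * log ⌊N⌋₊ ^ (κ - 1) * log N ^ (-(κ * log κ))
        ≤ C₁ * N * log N ^ (κ - 1) * log N ^ (-(κ * log κ)) := by
          have : 0 ≤ κ - 1 := by linarith
          gcongr
      _ = _ := by
          rw [mul_assoc, ← rpow_add hx0, ← sub_eq_add_neg, hη', mul_assoc]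
  have h2 : (S.card : ℝ) ≤ C₂ * (N * log N ^ (-η) * log (log N) ^ 5) := by
    refine (card_filter_exists_mul_eq_le (half_pos hκ0) hκ2 _ _ hS).trans ?_
    rw [rpow_neg_mul_log (half_pos hκ0) hx0]
    have := hfew _ hx _ hM (by rwa [exp_log hN0])
    rw [exp_log hN0] at this
    refine (mul_le_mul_of_nonneg_left this (by positivity)).trans_eq ?_
    rw [← hη'', sub_eq_add_neg (2 * (κ / 2) - 2), rpow_add hx0]
    ring
  have h3 : N * log N ^ (-η) ≤ N * log N ^ (-η) * log (log N) ^ 5 :=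
    le_mul_of_one_le_right (by positivity) (one_le_pow₀ hL)
  have h4 : (C₁ + C₂) * N * log (log N) ^ 5 / log N ^ η =
      (C₁ + C₂) * (N * log N ^ (-η) * log (log N) ^ 5) := by
    rw [rpow_neg hx0.le, div_eq_mul_inv]
    ring
  rw [h4]
  calc (countC N : ℝ) ≤ _ := Nat.cast_le.2 hle
    _ ≤ C₁ * (N * log N ^ (-η)) + C₂ * (N * log N ^ (-η) * log (log N) ^ 5) := by
      push_cast
      exact add_le_add h1 h2
    _ ≤ _ := by
      rw [add_mul]
      gcongr

theorem stmt_0 :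
    ∃ C K : ℝ, 0 < C ∧ 0 ≤ K ∧ ∀ N : ℝ, 16 ≤ N →
      (countC N : ℝ) ≤ C * N * Real.log (Real.log N) ^ K /
        Real.log N ^ (1 - (1 + Real.log (Real.log 2)) / Real.log 2) := by
  obtain ⟨C, x₀, hC, hx₀, h⟩ := exists_countC_le_of_large
  set η := 1 - (1 + log (log 2)) / log 2
  refine ⟨max C (x₀ ^ |η|), 5, lt_max_of_lt_left hC, by norm_num, fun N hN => ?_⟩
  have hN0 : 0 < N := by linarith
  have hx : exp 1 ≤ log N := by
    have h16 : log 16 = 4 * log 2 := by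
      rw [show (16 : ℝ) = 2 ^ 4 by norm_num, log_pow]
      norm_num
    linarith [log_le_log (by norm_num) hN, log_two_gt_d9, exp_one_lt_d9]
  have hx0 : 0 < log N := (exp_pos 1).trans_le hx
  have hL : 1 ≤ log (log N) := (le_log_iff_exp_le hx0).2 hx
  rw [rpow_ofNat]
  rcases le_or_gt x₀ (log N) with hlarge | hsmall
  · refine (h N hN hlarge).trans ?_
    gcongr
    exact le_max_left _ _
  · refine (countC_le hN0.le).trans ?_
    rw [le_div_iff₀ (by positivity)]
    have hx1 : 1 ≤ log N := by linarith [add_one_le_exp 1]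
    have hpow : log N ^ η ≤ max C (x₀ ^ |η|) :=
      (rpow_le_rpow_of_exponent_le hx1 (le_abs_self η)).trans
        ((rpow_le_rpow hx0.le hsmall.le (abs_nonneg η)).trans (le_max_right _ _))
    calc N * log N ^ η ≤ N * max C (x₀ ^ |η|) := by gcongr
      _ = max C (x₀ ^ |η|) * N := mul_comm _ _
      _ ≤ _ := le_mul_of_one_le_right (by positivity) (one_le_pow₀ hL)
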